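/- Let Ω ⊆ ℝⁿ be a nonempty open connected set (no regularity of ∂Ω is assumed), let a ∈ C¹([0,∞)) satisfy a(t) > 0 and (t·a(t))′ > 0 for all t ≥ 0, let f ∈ C¹(ℝ), and let u ∈ C¹(cl Ω) satisfy the stability inequality ∫_Ω f′(u)φ² dx ≤ ∫_Ω ⟨A(∇u)∇φ, ∇φ⟩ dx for every Lipschitz φ with compact support in Ω. Let w ∈ C¹(Ω) ∩ C(cl Ω) be a weak solution of div(A(∇u)∇w) + f′(u)·w = 0 in Ω with w ≥ 0 on ∂Ω, and suppose there exist Lipschitz functions φ_j : ℝⁿ → ℝ with compact support such that φ_j → 1 uniformly on compact subsets of cl Ω and ∫_Ω (w₋)²·⟨A(∇u)∇φ_j, ∇φ_j⟩ dx → 0 as j → ∞, where w₋ := max(−w, 0). Then either w ≡ 0 in Ω, or w < 0 everywhere in Ω, or w > 0 everywhere in Ω. -/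

import Mathlib

open MeasureTheory Set Metric Filter
open scoped RealInnerProductSpace Topology ENNReal

noncomputable section

variable {n : ℕ}

/-- The quasilinear operator matrix `A(p)` applied to a vector `v`:
`A(p)v = a(|p|) v + (a'(|p|)/|p|) ⟨p,v⟩ p` (with the second term vanishing at `p = 0`). -/
def Aop (a : ℝ → ℝ) (p v : EuclideanSpace ℝ (Fin n)) : EuclideanSpace ℝ (Fin n) :=
  a ‖p‖ • v + ((deriv a ‖p‖ / ‖p‖) * ⟪p, v⟫) • p

/-- `λ₁(t) = a(t) + t·a'(t) = (t a(t))'`. -/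
def lam1 (a : ℝ → ℝ) (t : ℝ) : ℝ := a t + t * deriv a t

/-- `λ₂(t) = a(t)`. -/
def lam2 (a : ℝ → ℝ) (t : ℝ) : ℝ := a t

/-- `λmax(t) = max{λ₁(t), λ₂(t)}`. -/
def lamMax (a : ℝ → ℝ) (t : ℝ) : ℝ := max (lam1 a t) (lam2 a t)

/-- A Lipschitz test function with compact support contained in `Ω`. -/
def IsTestOn (Ω : Set (EuclideanSpace ℝ (Fin n))) (φ : EuclideanSpace ℝ (Fin n) → ℝ) : Prop :=
  (∃ K, LipschitzWith K φ) ∧ HasCompactSupport φ ∧ tsupport φ ⊆ Ω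

/-- `u` is a weak solution of `div(a(|∇u|)∇u) + f(u) = 0` in `Ω`. -/
def IsWeakSolution (a f : ℝ → ℝ) (Ω : Set (EuclideanSpace ℝ (Fin n)))
    (u : EuclideanSpace ℝ (Fin n) → ℝ) : Prop :=
  ∀ φ : EuclideanSpace ℝ (Fin n) → ℝ, IsTestOn Ω φ →
    ∫ x in Ω, a ‖gradient u x‖ * ⟪gradient u x, gradient φ x⟫
      = ∫ x in Ω, f (u x) * φ x

/-- The stability inequality for a solution `u`. -/
def IsStable (a f : ℝ → ℝ) (Ω : Set (EuclideanSpace ℝ (Fin n)))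
    (u : EuclideanSpace ℝ (Fin n) → ℝ) : Prop :=
  ∀ φ : EuclideanSpace ℝ (Fin n) → ℝ, IsTestOn Ω φ →
    ∫ x in Ω, deriv f (u x) * φ x ^ 2
      ≤ ∫ x in Ω, ⟪Aop a (gradient u x) (gradient φ x), gradient φ x⟫

/-- `u` has moderate energy growth in `Ω₀`. -/
def ModerateEnergyGrowth (a : ℝ → ℝ) (u : EuclideanSpace ℝ (Fin n) → ℝ)
    (Ω₀ : Set (EuclideanSpace ℝ (Fin n))) : Prop :=
  ∃ φ : ℕ → EuclideanSpace ℝ (Fin n) → ℝ,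
    (∀ j, ∃ K, LipschitzWith K (φ j)) ∧
    (∀ j, HasCompactSupport (φ j)) ∧
    (∀ j x, 0 ≤ φ j x) ∧
    (∀ K : Set (EuclideanSpace ℝ (Fin n)), IsCompact K → K ⊆ closure Ω₀ →
      TendstoUniformlyOn (fun j => φ j) (fun _ => (1 : ℝ)) atTop K) ∧
    Tendsto (fun j => ∫ x in Ω₀, ‖gradient u x‖ ^ 2 *
        ⟪Aop a (gradient u x) (gradient (φ j) x), gradient (φ j) x⟫)
      atTop (nhds 0)

/-- A `C^k` domain: nonempty, open, connected, with boundary locally given by a regular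
`C^k` defining function. -/
def IsCkDomain (k : ℕ∞) (Ω : Set (EuclideanSpace ℝ (Fin n))) : Prop :=
  Ω.Nonempty ∧ IsOpen Ω ∧ IsConnected Ω ∧
    ∀ p ∈ frontier Ω, ∃ V : Set (EuclideanSpace ℝ (Fin n)),
      ∃ g : EuclideanSpace ℝ (Fin n) → ℝ,
        IsOpen V ∧ p ∈ V ∧ ContDiffOn ℝ k g V ∧ (∀ x ∈ V, gradient g x ≠ 0) ∧
        Ω ∩ V = {x ∈ V | g x < 0}

/-- A `C^k` domain together with its interior unit normal field `η`. -/
def IsCkDomainWithNormal (k : ℕ∞) (Ω : Set (EuclideanSpace ℝ (Fin n)))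
    (η : EuclideanSpace ℝ (Fin n) → EuclideanSpace ℝ (Fin n)) : Prop :=
  Ω.Nonempty ∧ IsOpen Ω ∧ IsConnected Ω ∧
    ∀ p ∈ frontier Ω, ∃ V : Set (EuclideanSpace ℝ (Fin n)),
      ∃ g : EuclideanSpace ℝ (Fin n) → ℝ,
        IsOpen V ∧ p ∈ V ∧ ContDiffOn ℝ k g V ∧ (∀ x ∈ V, gradient g x ≠ 0) ∧
        Ω ∩ V = {x ∈ V | g x < 0} ∧
        η p = -(‖gradient g p‖⁻¹ • gradient g p)

/-- `a ∈ C^{1,1}_loc([0,∞))`: `C¹` on `[0,∞)` with locally Lipschitz derivative. -/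
def C11Loc (a : ℝ → ℝ) : Prop :=
  ContDiffOn ℝ 1 a (Ici 0) ∧
    ∀ t ∈ Ici (0 : ℝ), ∃ V ∈ 𝓝[Ici (0 : ℝ)] t, ∃ K, LipschitzOnWith K (deriv a) V

section Calculus

variable {E : Type*} [NormedAddCommGroup E] [InnerProductSpace ℝ E] [CompleteSpace E]

theorem HasGradientAt.mul_real {f g : E → ℝ} {f' g' x : E} (hf : HasGradientAt f f' x)
    (hg : HasGradientAt g g' x) :
    HasGradientAt (fun y => f y * g y) (f x • g' + g x • f') x := by
  rw [hasGradientAt_iff_hasFDerivAt] at *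
  refine (hf.mul hg).congr_fderiv ?_
  ext v
  simp

theorem HasDerivAt.comp_hasGradientAt {φ : ℝ → ℝ} {φ' : ℝ} {f : E → ℝ} {f' x : E}
    (hφ : HasDerivAt φ φ' (f x)) (hf : HasGradientAt f f' x) :
    HasGradientAt (fun y => φ (f y)) (φ' • f') x := by
  rw [hasGradientAt_iff_hasFDerivAt] at *
  refine (hφ.comp_hasFDerivAt x hf).congr_fderiv ?_
  ext v
  simp

theorem HasGradientAt.comp_rescale {f : E → ℝ} {f' c x : E} {r : ℝ}
    (hf : HasGradientAt f f' (r • (x - c))) :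
    HasGradientAt (fun y => f (r • (y - c))) (r • f') x := by
  rw [hasGradientAt_iff_hasFDerivAt] at *
  have h1 : HasFDerivAt (fun y : E => r • (y - c)) (r • ContinuousLinearMap.id ℝ E) x :=
    ((hasFDerivAt_id x).sub_const c).const_smul r
  refine (hf.comp x h1).congr_fderiv ?_
  ext v
  simp

theorem HasGradientAt.hasDerivAt_comp {f : E → ℝ} {f' : E} {γ : ℝ → E} {γ' : E} {t : ℝ}
    (hf : HasGradientAt f f' (γ t)) (hγ : HasDerivAt γ γ' t) :
    HasDerivAt (fun s => f (γ s)) ⟪f', γ'⟫ t := by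
  rw [hasGradientAt_iff_hasFDerivAt] at hf
  exact (hf.comp_hasDerivAt t hγ).congr_deriv (by simp)

theorem norm_gradient_le_of_lipschitz {f : E → ℝ} {K : NNReal} (hf : LipschitzWith K f) (x : E) :
    ‖gradient f x‖ ≤ K := by
  simpa [gradient] using norm_fderiv_le_of_lipschitz ℝ hf (x₀ := x)

theorem gradient_eq_zero_of_notMem_tsupport {f : E → ℝ} {x : E} (hx : x ∉ tsupport f) :
    gradient f x = 0 := by
  have := notMem_tsupport_iff_eventuallyEq.1 hx
  rw [this.gradient_eq]
  exact gradient_const' (F := E) (𝕜 := ℝ) (0 : ℝ) |> fun h => congrFun h x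

theorem measurable_gradient [MeasurableSpace E] [BorelSpace E] (f : E → ℝ) :
    Measurable (gradient f) :=
  (InnerProductSpace.toDual ℝ E).symm.continuous.measurable.comp (measurable_fderiv ℝ f)

theorem hasDerivAt_sq_max_zero (t : ℝ) :
    HasDerivAt (fun s : ℝ => max s 0 ^ 2) (2 * max t 0) t := by
  rcases lt_trichotomy t 0 with h | h | h
  · have : (fun s : ℝ => max s 0 ^ 2) =ᶠ[𝓝 t] fun _ => 0 := by
      filter_upwards [gt_mem_nhds h] with s hs
      simp [max_eq_right hs.le]
    rw [max_eq_right h.le]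
    simpa using (hasDerivAt_const t (0 : ℝ)).congr_of_eventuallyEq this
  · subst h
    rw [hasDerivAt_iff_isLittleO_nhds_zero]
    simp only [zero_add, max_self, mul_zero, smul_zero, sub_zero, ne_eq, OfNat.ofNat_ne_zero,
      not_false_eq_true, zero_pow]
    refine (Asymptotics.IsBigO.of_bound 1 (Eventually.of_forall fun s => ?_)).trans_isLittleO
      (Asymptotics.isLittleO_pow_id one_lt_two)
    rw [one_mul, norm_pow, norm_pow]
    gcongr
    rw [Real.norm_eq_abs, Real.norm_eq_abs, abs_of_nonneg (le_max_right _ _)]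
    exact max_le (le_abs_self _) (abs_nonneg _)
  · have : (fun s : ℝ => max s 0 ^ 2) =ᶠ[𝓝 t] fun s => s ^ 2 := by
      filter_upwards [lt_mem_nhds h] with s hs
      simp [max_eq_left hs.le]
    rw [max_eq_left h.le]
    simpa using (hasDerivAt_pow 2 t).congr_of_eventuallyEq this

end Calculus

section Lipschitz

variable {X : Type*} [PseudoMetricSpace X]

theorem exists_lipschitzWith_mul {f g : X → ℝ} (hf : ∃ K, LipschitzWith K f)
    (hg : ∃ K, LipschitzWith K g) {a b : ℝ} (hfb : ∀ x, |f x| ≤ a) (hgb : ∀ x, |g x| ≤ b) :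
    ∃ K, LipschitzWith K (fun x => f x * g x) := by
  obtain ⟨K, hK⟩ := hf
  obtain ⟨L, hL⟩ := hg
  refine ⟨_, LipschitzWith.of_dist_le' (K := a * L + b * K) fun x y => ?_⟩
  have h1 := hK.dist_le_mul x y
  have h2 := hL.dist_le_mul x y
  rw [Real.dist_eq] at *
  have : f x * g x - f y * g y = f x * (g x - g y) + g y * (f x - f y) := by ring
  rw [this]
  refine (abs_add_le _ _).trans ?_
  rw [abs_mul, abs_mul, add_mul, mul_assoc, mul_assoc]
  have ha := (abs_nonneg _).trans (hfb x)
  have hb := (abs_nonneg _).trans (hgb x)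
  gcongr
  · exact hfb x
  · exact hgb y

theorem exists_lipschitzWith_inv_add {f : X → ℝ} (hf : ∃ K, LipschitzWith K f)
    (hf0 : ∀ x, 0 ≤ f x) {ε : ℝ} (hε : 0 < ε) :
    ∃ K, LipschitzWith K (fun x => (f x + ε)⁻¹) := by
  obtain ⟨K, hK⟩ := hf
  refine ⟨_, LipschitzWith.of_dist_le' (K := ε⁻¹ * ε⁻¹ * K) fun x y => ?_⟩
  have h1 := hK.dist_le_mul x y
  have hx : 0 < f x + ε := by linarith [hf0 x]
  have hy : 0 < f y + ε := by linarith [hf0 y]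
  rw [Real.dist_eq] at *
  have : (f x + ε)⁻¹ - (f y + ε)⁻¹ = (f x + ε)⁻¹ * (f y + ε)⁻¹ * (f y - f x) := by
    field_simp; ring
  have hx' : (f x + ε)⁻¹ ≤ ε⁻¹ := by gcongr; linarith [hf0 x]
  have hy' : (f y + ε)⁻¹ ≤ ε⁻¹ := by gcongr; linarith [hf0 y]
  rw [this, abs_mul, abs_of_pos (by positivity), abs_sub_comm, mul_assoc _ (K : ℝ)]
  gcongr

theorem exists_lipschitzWith_log_add {f : X → ℝ} (hf : ∃ K, LipschitzWith K f)
    (hf0 : ∀ x, 0 ≤ f x) {ε : ℝ} (hε : 0 < ε) :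
    ∃ K, LipschitzWith K (fun x => Real.log (f x + ε)) := by
  obtain ⟨K, hK⟩ := hf
  refine ⟨_, LipschitzWith.of_le_add_mul (ε⁻¹ * K).toNNReal fun x y => ?_⟩
  rw [Real.coe_toNNReal _ (by positivity)]
  have h1 := hK.dist_le_mul x y
  have hx : 0 < f x + ε := by linarith [hf0 x]
  have hy : 0 < f y + ε := by linarith [hf0 y]
  rw [Real.dist_eq] at h1
  have h2 := Real.log_le_sub_one_of_pos (div_pos hx hy)
  rw [Real.log_div hx.ne' hy.ne'] at h2
  have h3 : (f x + ε) / (f y + ε) - 1 = (f x - f y) * (f y + ε)⁻¹ := by field_simp; ring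
  have h4 : (f x - f y) * (f y + ε)⁻¹ ≤ (K * dist x y) * ε⁻¹ := by
    have : (f y + ε)⁻¹ ≤ ε⁻¹ := by gcongr; linarith [hf0 y]
    calc _ ≤ |f x - f y| * (f y + ε)⁻¹ := by gcongr; exact le_abs_self _
      _ ≤ _ := by gcongr
  nlinarith

end Lipschitz

section Rademacher

variable {E : Type*} [NormedAddCommGroup E] [InnerProductSpace ℝ E] [FiniteDimensional ℝ E]
  [MeasurableSpace E] [BorelSpace E]

theorem ae_hasGradientAt_max_zero {μ : Measure E} [μ.IsAddHaarMeasure] {g : E → ℝ} {K : NNReal}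
    (hL : LipschitzWith K g) (hg : Differentiable ℝ g) (d : ℝ) :
    ∀ᵐ x ∂μ, HasGradientAt (fun y => max (g y - d) 0) (if d < g x then gradient g x else 0) x := by
  have hL' : LipschitzWith K (fun y => max (g y - d) 0) := by
    refine LipschitzWith.max_const ?_ 0
    exact LipschitzWith.of_dist_le_mul fun x y => by simpa using hL.dist_le_mul x y
  filter_upwards [hL'.ae_differentiableAt (μ := μ)] with x hx
  split_ifs with h
  · have : (fun y => max (g y - d) 0) =ᶠ[𝓝 x] fun y => g y - d := by
      filter_upwards [hg.continuous.continuousAt.eventually (lt_mem_nhds h)] with y hy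
      exact max_eq_left (by linarith)
    refine HasGradientAt.congr_of_eventuallyEq ?_ this
    have := (hg x).hasGradientAt
    rw [hasGradientAt_iff_hasFDerivAt] at *
    exact this.sub_const d
  · have hmin : IsLocalMin (fun y => max (g y - d) 0) x := by
      refine Eventually.of_forall fun y => ?_
      simp only [max_eq_right (show g x - d ≤ 0 by linarith)]
      exact le_max_right _ _
    have h1 := hx.hasGradientAt
    rwa [gradient, hmin.fderiv_eq_zero, map_zero] at h1

theorem integrable_of_bounded_on_compact {V : Type*} [TopologicalSpace V] [T2Space V]
    [MeasurableSpace V] [OpensMeasurableSpace V] {F : Type*} [NormedAddCommGroup F]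
    {μ : Measure V} [IsFiniteMeasureOnCompacts μ] {g : V → F}
    (hg : AEStronglyMeasurable g μ) {K : Set V} (hK : IsCompact K) {C : ℝ}
    (hb : ∀ x ∈ K, ‖g x‖ ≤ C) (h0 : ∀ x ∉ K, g x = 0) : Integrable g μ := by
  have h1 : IntegrableOn g K μ :=
    Measure.integrableOn_of_bounded hK.measure_lt_top.ne hg
      ((ae_restrict_iff' hK.measurableSet).2 (Eventually.of_forall hb))
  refine (integrableOn_iff_integrable_of_support_subset fun x hx => ?_).1 h1
  by_contra h
  exact hx (h0 x h)

theorem integrable_inner_apply {μ : Measure E} [IsFiniteMeasureOnCompacts μ]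
    {A : E → E →L[ℝ] E} (hA : Continuous A) {X Y : E → E} (hX : Measurable X) (hY : Measurable Y)
    {K : Set E} (hK : IsCompact K) {a b : ℝ} (hXb : ∀ x ∈ K, ‖X x‖ ≤ a) (hYb : ∀ x ∈ K, ‖Y x‖ ≤ b)
    (h0 : ∀ x ∉ K, X x = 0 ∨ Y x = 0) :
    Integrable (fun x => ⟪A x (X x), Y x⟫) μ := by
  obtain ⟨C, hC⟩ := hK.exists_bound_of_continuousOn hA.continuousOn
  refine integrable_of_bounded_on_compact (C := C * a * b) ?_ hK (fun x hx => ?_)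
    fun x hx => ?_
  · have h1 : Measurable fun x => A x (X x) :=
      isBoundedBilinearMap_apply.continuous.measurable.comp (hA.measurable.prodMk hX)
    exact (h1.inner hY).aestronglyMeasurable
  · have hC0 := (norm_nonneg _).trans (hC x hx)
    have ha0 := (norm_nonneg _).trans (hXb x hx)
    refine (norm_inner_le_norm _ _).trans ?_
    gcongr
    · exact ((A x).le_opNorm _).trans (by gcongr; exacts [hC x hx, hXb x hx])
    · exact hYb x hx
  · rcases h0 x hx with h | h <;> simp [h]

theorem exists_contDiff_cutoff {V : Type*} [NormedAddCommGroup V] [NormedSpace ℝ V]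
    [FiniteDimensional ℝ V] {Ω K : Set V} (hΩ : IsOpen Ω) (hK : IsCompact K) (hKΩ : K ⊆ Ω) :
    ∃ χ : V → ℝ, ContDiff ℝ 1 χ ∧ HasCompactSupport χ ∧ tsupport χ ⊆ Ω ∧
      (∀ x, χ x ∈ Icc (0 : ℝ) 1) ∧ ∃ U, IsOpen U ∧ K ⊆ U ∧ ∀ x ∈ U, χ x = 1 := by
  obtain ⟨L, hL, hKL, hLΩ⟩ := exists_compact_between hK hΩ hKΩ
  obtain ⟨f, hf1, hf0, hf⟩ := exists_contMDiffMap_one_nhds_of_subset_interior (n := 1)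
    (modelWithCornersSelf ℝ V) hK.isClosed hKL
  have hsupp : tsupport f ⊆ L := by
    refine closure_minimal (fun x hx => ?_) hL.isClosed
    by_contra h
    exact hx (hf0 x h)
  refine ⟨f, f.contMDiff.contDiff, hL.of_isClosed_subset (isClosed_tsupport _) hsupp,
    hsupp.trans hLΩ, hf, ?_⟩
  obtain ⟨U, hKU, hU, h⟩ := mem_nhdsSet_iff_exists.1 hf1
  exact ⟨U, hKU, hU, h⟩

theorem contDiff_mul_of_tsupport_subset {V : Type*} [NormedAddCommGroup V] [NormedSpace ℝ V]
    {Ω : Set V} (hΩ : IsOpen Ω) {χ g : V → ℝ}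
    (hχ : ContDiff ℝ 1 χ) (hs : tsupport χ ⊆ Ω) (hg : ContDiffOn ℝ 1 g Ω) :
    ContDiff ℝ 1 (fun x => χ x * g x) := by
  rw [contDiff_iff_contDiffAt]
  intro x
  by_cases hx : x ∈ Ω
  · exact hχ.contDiffAt.mul (hg.contDiffAt (hΩ.mem_nhds hx))
  · have : (fun x => χ x * g x) =ᶠ[𝓝 x] fun _ => 0 := by
      filter_upwards [notMem_tsupport_iff_eventuallyEq.1 fun h => hx (hs h)] with y hy
      simp [hy]
    exact contDiffAt_const.congr_of_eventuallyEq this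

end Rademacher

section Kernel

variable {E : Type*} [NormedAddCommGroup E] [InnerProductSpace ℝ E] [FiniteDimensional ℝ E]
  [MeasurableSpace E] [BorelSpace E]

/-- A compactly supported profile adapted to a constant coefficient operator `A₀`: its square
has `A₀`-flux equal to `-4 η(z) z`. -/
structure EllipticKernel (A₀ : E →L[ℝ] E) where
  /-- the inverse operator -/
  B : E →L[ℝ] E
  /-- the profile -/
  η : E → ℝ
  /-- the radius of a ball containing the support of the profile -/
  D : ℝ
  D_pos : 0 < D
  apply_B : ∀ z, A₀ (B z) = z
  continuous_η : Continuous η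
  η_nonneg : ∀ z, 0 ≤ η z
  η_le_one : ∀ z, η z ≤ 1
  η_eq_zero : ∀ z, D ≤ ‖z‖ → η z = 0
  lipschitz_sq : ∃ K, LipschitzWith K fun z => η z ^ 2
  hasGradientAt_sq : ∀ z, HasGradientAt (fun z => η z ^ 2) ((-(4 * η z)) • B z) z
  integral_pos : 0 < ∫ z, η z

theorem exists_ellipticKernel {A₀ : E →L[ℝ] E} (hsymm : ∀ v w, ⟪A₀ v, w⟫ = ⟪v, A₀ w⟫) {l : ℝ}
    (hl : 0 < l) (hcoer : ∀ v, l * ‖v‖ ^ 2 ≤ ⟪A₀ v, v⟫) : Nonempty (EllipticKernel A₀) := by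
  have hinj : Function.Injective (A₀ : E →ₗ[ℝ] E) := by
    rw [← LinearMap.ker_eq_bot, LinearMap.ker_eq_bot']
    intro v hv
    have h := hcoer v
    rw [show A₀ v = 0 from hv, inner_zero_left] at h
    have : ‖v‖ ^ 2 = 0 := le_antisymm (by nlinarith) (by positivity)
    simpa using this
  let e := LinearEquiv.ofInjectiveEndo _ hinj
  let B : E →L[ℝ] E := LinearMap.toContinuousLinearMap (e.symm : E →ₗ[ℝ] E)
  have hB : ∀ z, A₀ (B z) = z := fun z => e.apply_symm_apply z
  have hBsymm : ∀ v w, ⟪B v, w⟫ = ⟪v, B w⟫ := fun v w => by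
    conv_lhs => rw [← hB w]
    rw [← hsymm, hB]
  set M : ℝ := ‖A₀‖ + 1 with hM
  have hM0 : 0 < M := by positivity
  have hq : ∀ z, l * (‖z‖ / M) ^ 2 ≤ ⟪B z, z⟫ := fun z => by
    have h1 := hcoer (B z)
    rw [hB, real_inner_comm] at h1
    refine le_trans ?_ h1
    gcongr
    rw [div_le_iff₀ hM0]
    calc ‖z‖ = ‖A₀ (B z)‖ := by rw [hB]
      _ ≤ ‖A₀‖ * ‖B z‖ := A₀.le_opNorm _
      _ ≤ ‖B z‖ * M := by rw [hM]; nlinarith [norm_nonneg (B z), norm_nonneg A₀]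
  have hq0 : ∀ z, 0 ≤ ⟪B z, z⟫ := fun z => le_trans (by positivity) (hq z)
  set η : E → ℝ := fun z => max (1 - ⟪B z, z⟫) 0 with hη
  set D : ℝ := M * (1 / l + 1) with hD
  have hD0 : 0 < D := by positivity
  have hcont : Continuous η := by fun_prop
  have hzero : ∀ z, D ≤ ‖z‖ → η z = 0 := fun z hz => by
    refine max_eq_right ?_
    have h1 := hq z
    have h2 : 1 / l + 1 ≤ ‖z‖ / M := by rw [le_div_iff₀ hM0]; linarith [hD]
    have h3 : l * (1 / l + 1) ^ 2 ≤ l * (‖z‖ / M) ^ 2 := by gcongr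
    have h4 : l * (1 / l + 1) ^ 2 = 1 / l + 2 + l := by field_simp; ring
    have : 0 < 1 / l := by positivity
    linarith
  have hle : ∀ z, η z ≤ 1 := fun z => max_le (by linarith [hq0 z]) zero_le_one
  have hnn : ∀ z, 0 ≤ η z := fun z => le_max_right _ _
  have hgrad : ∀ z, HasGradientAt (fun z => η z ^ 2) ((-(4 * η z)) • B z) z := fun z => by
    have h1 : HasGradientAt (fun z => 1 - ⟪B z, z⟫) (-((2 : ℝ) • B z)) z := by
      rw [hasGradientAt_iff_hasFDerivAt]
      refine ((B.hasFDerivAt.inner ℝ (hasFDerivAt_id z)).const_sub 1).congr_fderiv ?_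
      ext v
      simp [hBsymm v z, real_inner_comm v (B z)]
      ring
    have := (hasDerivAt_sq_max_zero (1 - ⟪B z, z⟫)).comp_hasGradientAt
      (f := fun z => 1 - ⟪B z, z⟫) h1
    convert this using 1
    rw [smul_neg, smul_smul, neg_smul, hη]
    ring_nf
  have hlip : ∃ K, LipschitzWith K fun z => η z ^ 2 := by
    refine ⟨(4 * (‖B‖ * D)).toNNReal, lipschitzWith_of_nnnorm_fderiv_le (𝕜 := ℝ)
      (fun z => (hgrad z).differentiableAt) fun z => ?_⟩
    rw [← NNReal.coe_le_coe, coe_nnnorm, Real.coe_toNNReal _ (by positivity),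
      (hasGradientAt_iff_hasFDerivAt.1 (hgrad z)).fderiv, LinearIsometryEquiv.norm_map, norm_smul,
      norm_neg, Real.norm_of_nonneg (by linarith [hnn z])]
    by_cases hz : D ≤ ‖z‖
    · rw [hzero z hz]; simp; positivity
    · have h1 : ‖B z‖ ≤ ‖B‖ * D :=
        (B.le_opNorm z).trans (by gcongr; exact (not_le.1 hz).le)
      have := hle z
      have := hnn z
      gcongr
      linarith
  have hint : 0 < ∫ z, η z := by
    refine hcont.integral_pos_of_hasCompactSupport_nonneg_nonzero
      (HasCompactSupport.intro (isCompact_closedBall (0 : E) D) fun z hz => hzero z ?_) hnn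
      (x := 0) ?_
    · simp only [mem_closedBall, dist_zero_right, not_le] at hz
      exact hz.le
    · simp [hη]
  exact ⟨⟨B, η, D, hD0, hB, hcont, hnn, hle, hzero, hlip, hgrad, hint⟩⟩

theorem integral_comp_rescale (F : E → ℝ) (x : E) {r : ℝ} (hr : 0 < r) :
    ∫ y, F (r⁻¹ • (y - x)) = r ^ Module.finrank ℝ E * ∫ z, F z := by
  rw [integral_sub_right_eq_self (fun y => F (r⁻¹ • y)) x,
    Measure.integral_comp_smul volume F r⁻¹, inv_pow, inv_inv, abs_of_pos (by positivity),
    smul_eq_mul]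

end Kernel

/-- The gradient of the positive part of a `C¹` function, with value `0` where `g ≤ 0`. -/
def posGradient (g : EuclideanSpace ℝ (Fin n) → ℝ) (x : EuclideanSpace ℝ (Fin n)) :
    EuclideanSpace ℝ (Fin n) :=
  if 0 < g x then gradient g x else 0

/-- The gradient of `log (g₊ + ε)`. -/
def logGradient (g : EuclideanSpace ℝ (Fin n) → ℝ) (ε : ℝ) (x : EuclideanSpace ℝ (Fin n)) :
    EuclideanSpace ℝ (Fin n) :=
  (max (g x) 0 + ε)⁻¹ • posGradient g x

section LocalAnalysis

variable {g c : EuclideanSpace ℝ (Fin n) → ℝ} {ε : ℝ}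
  {A : EuclideanSpace ℝ (Fin n) → EuclideanSpace ℝ (Fin n) →L[ℝ] EuclideanSpace ℝ (Fin n)}
  {A₀ : EuclideanSpace ℝ (Fin n) →L[ℝ] EuclideanSpace ℝ (Fin n)}
  {U : Set (EuclideanSpace ℝ (Fin n))}

theorem measurable_posGradient (hg : Measurable g) : Measurable (posGradient g) :=
  Measurable.ite (measurableSet_lt measurable_const hg) (measurable_gradient g) measurable_const

theorem measurable_logGradient (hg : Measurable g) : Measurable (logGradient g ε) :=
  (((hg.max measurable_const).add_const ε).inv).smul (measurable_posGradient hg)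

theorem norm_posGradient_le {K : NNReal} (hL : LipschitzWith K g) (x : EuclideanSpace ℝ (Fin n)) :
    ‖posGradient g x‖ ≤ K := by
  unfold posGradient
  split_ifs
  · exact norm_gradient_le_of_lipschitz hL x
  · simp

theorem norm_logGradient_le {K : NNReal} (hL : LipschitzWith K g) (hε : 0 < ε)
    (x : EuclideanSpace ℝ (Fin n)) : ‖logGradient g ε x‖ ≤ ε⁻¹ * K := by
  have h0 : 0 ≤ max (g x) 0 := le_max_right _ _
  rw [logGradient, norm_smul, Real.norm_of_nonneg (by positivity)]
  gcongr
  · linarith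
  · exact norm_posGradient_le hL x

theorem ae_hasGradientAt_posPart {K : NNReal} (hL : LipschitzWith K g) (hg : Differentiable ℝ g) :
    ∀ᵐ x, HasGradientAt (fun y => max (g y) 0) (posGradient g x) x := by
  simpa using! ae_hasGradientAt_max_zero (μ := volume) hL hg 0

theorem ae_hasGradientAt_log {K : NNReal} (hL : LipschitzWith K g) (hg : Differentiable ℝ g)
    (hε : 0 < ε) :
    ∀ᵐ x, HasGradientAt (fun y => Real.log (max (g y) 0 + ε)) (logGradient g ε x) x := by
  filter_upwards [ae_hasGradientAt_posPart hL hg] with x hx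
  have h0 : 0 < max (g x) 0 + ε := by have := le_max_right (g x) 0; linarith
  have h1 : HasDerivAt (fun t => Real.log (t + ε)) (max (g x) 0 + ε)⁻¹ (max (g x) 0) := by
    simpa using ((hasDerivAt_id (max (g x) 0)).add_const ε).log h0.ne'
  exact h1.comp_hasGradientAt (f := fun y => max (g y) 0) hx

theorem kernel_test_function (hg : ContDiff ℝ 1 g) (hgs : HasCompactSupport g)
    (k : EllipticKernel A₀) {x : EuclideanSpace ℝ (Fin n)} {r : ℝ} (hr : 0 < r) (hε : 0 < ε)
    (hU : closedBall x (r * k.D) ⊆ U) :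
    IsTestOn U (fun y => k.η (r⁻¹ • (y - x)) ^ 2 * (max (g y) 0 + ε)⁻¹) := by
  obtain ⟨K, hK⟩ := hg.lipschitzWith_of_hasCompactSupport hgs one_ne_zero
  have hzero : ∀ y, y ∉ closedBall x (r * k.D) →
      k.η (r⁻¹ • (y - x)) ^ 2 * (max (g y) 0 + ε)⁻¹ = 0 := fun y hy => by
    rw [k.η_eq_zero, zero_pow two_ne_zero, zero_mul]
    rw [norm_smul, Real.norm_of_nonneg (by positivity), ← dist_eq_norm,
      le_inv_mul_iff₀ hr]
    exact (not_le.1 hy).le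
  refine ⟨?_, HasCompactSupport.intro (isCompact_closedBall _ _) hzero, ?_⟩
  · have h1 : ∃ L, LipschitzWith L fun y => k.η (r⁻¹ • (y - x)) ^ 2 := by
      obtain ⟨L, hL⟩ := k.lipschitz_sq
      have h2 : LipschitzWith (r⁻¹).toNNReal fun y : EuclideanSpace ℝ (Fin n) => r⁻¹ • (y - x) := by
        refine LipschitzWith.of_dist_le_mul fun y z => ?_
        rw [dist_smul₀, dist_sub_right, Real.norm_of_nonneg (by positivity),
          Real.coe_toNNReal _ (by positivity)]
      exact ⟨_, hL.comp h2⟩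
    refine exists_lipschitzWith_mul (a := 1) (b := ε⁻¹) h1
      (exists_lipschitzWith_inv_add ⟨K, hK.max_const 0⟩ (fun y => le_max_right _ _) hε)
      (fun y => ?_) fun y => ?_
    · rw [abs_of_nonneg (by positivity)]
      exact pow_le_one₀ (k.η_nonneg _) (k.η_le_one _)
    · have h0 : 0 ≤ max (g y) 0 := le_max_right _ _
      rw [abs_of_nonneg (by positivity)]
      gcongr
      linarith
  · refine (closure_minimal (fun y hy => ?_) isClosed_closedBall).trans hU
    by_contra h
    exact hy (hzero y h)

theorem integral_kernel_identity (hA : Continuous A) (hc : Continuous c) (hg : ContDiff ℝ 1 g)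
    (hgs : HasCompactSupport g)
    (heq : ∀ ψ, IsTestOn U ψ →
      ∫ y, ⟪A y (posGradient g y), gradient ψ y⟫ = ∫ y, c y * max (g y) 0 * ψ y)
    (k : EllipticKernel A₀) {x : EuclideanSpace ℝ (Fin n)} {r : ℝ} (hr : 0 < r) (hε : 0 < ε)
    (hU : closedBall x (r * k.D) ⊆ U)
    {T : EuclideanSpace ℝ (Fin n) → ℝ}
    (hT : ∀ z, T z = k.η z ^ 2 *
        ⟪A (x + r • z) (logGradient g ε (x + r • z)), logGradient g ε (x + r • z)⟫
      + 4 / r * (k.η z * ⟪A (x + r • z) (logGradient g ε (x + r • z)), k.B z⟫)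
      + c (x + r • z) * (max (g (x + r • z)) 0 / (max (g (x + r • z)) 0 + ε)) * k.η z ^ 2) :
    Integrable T ∧ ∫ z, T z = 0 := by
  obtain ⟨K, hK⟩ := hg.lipschitzWith_of_hasCompactSupport hgs one_ne_zero
  have hpos : ∀ y, 0 < max (g y) 0 + ε := fun y => by
    have := le_max_right (g y) 0; linarith
  have hgc := hg.continuous
  have hresc : Continuous fun z : EuclideanSpace ℝ (Fin n) => x + r • z := by fun_prop
  have hη0 : ∀ z, z ∉ closedBall (0 : EuclideanSpace ℝ (Fin n)) k.D → k.η z = 0 := fun z hz =>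
    k.η_eq_zero z (by simp only [mem_closedBall, dist_zero_right, not_le] at hz; exact hz.le)
  have hVm : Measurable fun z => logGradient g ε (x + r • z) :=
    (measurable_logGradient hgc.measurable).comp hresc.measurable
  have hTint : Integrable T := by
    have h1 : Integrable fun z =>
        ⟪A (x + r • z) (logGradient g ε (x + r • z)), k.η z ^ 2 • logGradient g ε (x + r • z)⟫ := by
      refine integrable_inner_apply (A := fun z => A (x + r • z)) (hA.comp hresc)
        (Y := fun z => k.η z ^ 2 • logGradient g ε (x + r • z)) hVm
        ((k.continuous_η.measurable.pow_const 2).smul hVm)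
        (isCompact_closedBall 0 k.D) (a := ε⁻¹ * K) (b := 1 * (ε⁻¹ * K))
        (fun z _ => norm_logGradient_le hK hε _) (fun z _ => ?_) fun z hz => Or.inr ?_
      · rw [norm_smul, norm_pow, Real.norm_of_nonneg (k.η_nonneg z)]
        gcongr
        · exact pow_le_one₀ (k.η_nonneg _) (k.η_le_one _)
        · exact norm_logGradient_le hK hε _
      · simp [hη0 z hz]
    have h2 : Integrable fun z =>
        ⟪A (x + r • z) (logGradient g ε (x + r • z)), k.η z • k.B z⟫ := by
      refine integrable_inner_apply (A := fun z => A (x + r • z)) (hA.comp hresc)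
        (Y := fun z => k.η z • k.B z) hVm
        (k.continuous_η.measurable.smul k.B.continuous.measurable)
        (isCompact_closedBall 0 k.D) (a := ε⁻¹ * K) (b := 1 * (‖k.B‖ * k.D))
        (fun z _ => norm_logGradient_le hK hε _) (fun z hz => ?_) fun z hz => Or.inr ?_
      · rw [norm_smul, Real.norm_of_nonneg (k.η_nonneg z)]
        gcongr
        · exact k.η_le_one _
        · exact (k.B.le_opNorm z).trans (by gcongr; simpa using hz)
      · simp [hη0 z hz]
    have h3 : Integrable fun z => c (x + r • z) *
        (max (g (x + r • z)) 0 / (max (g (x + r • z)) 0 + ε)) * k.η z ^ 2 := by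
      refine Continuous.integrable_of_hasCompactSupport ?_
        (HasCompactSupport.intro (isCompact_closedBall (0 : EuclideanSpace ℝ (Fin n)) k.D)
          fun z hz => by simp [hη0 z hz])
      have hP : Continuous fun z => max (g (x + r • z)) 0 := (hgc.comp hresc).max continuous_const
      exact ((hc.comp hresc).mul (hP.div₀ (hP.add continuous_const) fun z => (hpos _).ne')).mul
        (k.continuous_η.pow 2)
    have h4 := (h1.add (h2.const_mul (4 / r))).add h3
    refine h4.congr (Eventually.of_forall fun z => ?_)
    simp only [Pi.add_apply, hT, inner_smul_right]
  refine ⟨hTint, ?_⟩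
  set ψ : EuclideanSpace ℝ (Fin n) → ℝ :=
    fun y => k.η (r⁻¹ • (y - x)) ^ 2 * (max (g y) 0 + ε)⁻¹ with hψ
  have htest : IsTestOn U ψ := kernel_test_function hg hgs k hr hε hU
  have hψgrad : ∀ᵐ y, gradient ψ y = k.η (r⁻¹ • (y - x)) ^ 2 •
        (-(max (g y) 0 + ε)⁻¹ • logGradient g ε y)
      + (max (g y) 0 + ε)⁻¹ • r⁻¹ • (-(4 * k.η (r⁻¹ • (y - x)))) • k.B (r⁻¹ • (y - x)) := by
    filter_upwards [ae_hasGradientAt_posPart hK (hg.differentiable one_ne_zero)] with y hy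
    have h1 : HasDerivAt (fun t => (t + ε)⁻¹) (-(max (g y) 0 + ε)⁻¹ * (max (g y) 0 + ε)⁻¹)
        (max (g y) 0) := by
      refine (((hasDerivAt_id (max (g y) 0)).add_const ε).inv (hpos y).ne').congr_deriv ?_
      simp only [id_eq]
      field_simp
    have h2 := h1.comp_hasGradientAt (f := fun y => max (g y) 0) hy
    have h3 := (k.hasGradientAt_sq (r⁻¹ • (y - x))).comp_rescale
    rw [(h3.mul_real h2).gradient, logGradient, smul_smul (-(max (g y) 0 + ε)⁻¹)]
  have hae : ∀ᵐ y, c y * max (g y) 0 * ψ y - ⟪A y (posGradient g y), gradient ψ y⟫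
      = T (r⁻¹ • (y - x)) := by
    filter_upwards [hψgrad] with y hy
    have hxy : x + r • r⁻¹ • (y - x) = y := by
      rw [smul_smul, mul_inv_cancel₀ hr.ne', one_smul, add_sub_cancel]
    have hpg : posGradient g y = (max (g y) 0 + ε) • logGradient g ε y := by
      rw [logGradient, smul_smul, mul_inv_cancel₀ (hpos y).ne', one_smul]
    rw [hT, hxy, hy, hpg, map_smul, inner_smul_left, inner_add_right, hψ]
    simp only [inner_smul_right, conj_trivial]
    have := (hpos y).ne'
    field_simp
    ring
  have hint1 : Integrable fun y => ⟪A y (posGradient g y), gradient ψ y⟫ := by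
    obtain ⟨⟨L, hL⟩, hcs, -⟩ := htest
    exact integrable_inner_apply hA (measurable_posGradient hgc.measurable) (measurable_gradient ψ)
      hcs (fun y _ => norm_posGradient_le hK y) (fun y _ => norm_gradient_le_of_lipschitz hL y)
      fun y hy => Or.inr (gradient_eq_zero_of_notMem_tsupport hy)
  have hint2 : Integrable fun y => c y * max (g y) 0 * ψ y := by
    obtain ⟨⟨L, hL⟩, hcs, -⟩ := htest
    exact ((hc.mul (hgc.max continuous_const)).mul hL.continuous).integrable_of_hasCompactSupport
      hcs.mul_left
  have h0 : ∫ y, T (r⁻¹ • (y - x)) = 0 := by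
    rw [← integral_congr_ae hae, integral_sub hint2 hint1, heq ψ htest, sub_self]
  rw [integral_comp_rescale T x hr] at h0
  exact (mul_eq_zero.1 h0).resolve_left (by positivity)

end LocalAnalysis

section LocalEstimates

variable {g c : EuclideanSpace ℝ (Fin n) → ℝ} {ε : ℝ}
  {A : EuclideanSpace ℝ (Fin n) → EuclideanSpace ℝ (Fin n) →L[ℝ] EuclideanSpace ℝ (Fin n)}
  {A₀ : EuclideanSpace ℝ (Fin n) →L[ℝ] EuclideanSpace ℝ (Fin n)}
  {U : Set (EuclideanSpace ℝ (Fin n))}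

/-- A multiple of a mean-zero function plus a constant on the support ball of the kernel. -/
theorem integral_kernel_bound (k : EllipticKernel A₀) {T : EuclideanSpace ℝ (Fin n) → ℝ}
    (hT : Integrable T) (hT0 : ∫ z, T z = 0) (a b : ℝ) :
    Integrable (fun z => a * T z + (closedBall 0 k.D).indicator (fun _ => b) z) ∧
    ∫ z, (a * T z + (closedBall 0 k.D).indicator (fun _ => b) z)
      = b * volume.real (closedBall (0 : EuclideanSpace ℝ (Fin n)) k.D) := by
  have h1 : Integrable ((closedBall (0 : EuclideanSpace ℝ (Fin n)) k.D).indicator fun _ => b) :=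
    (integrableOn_const (isCompact_closedBall _ _).measure_lt_top.ne).integrable_indicator
      measurableSet_closedBall
  refine ⟨(hT.const_mul a).add h1, ?_⟩
  rw [integral_add (hT.const_mul a) h1, integral_const_mul, hT0,
    integral_indicator measurableSet_closedBall, setIntegral_const, smul_eq_mul]
  ring

theorem abs_integral_kernel_inner_le (hA : Continuous A) (hc : Continuous c)
    (hg : ContDiff ℝ 1 g) (hgs : HasCompactSupport g)
    (heq : ∀ ψ, IsTestOn U ψ →
      ∫ y, ⟪A y (posGradient g y), gradient ψ y⟫ = ∫ y, c y * max (g y) 0 * ψ y)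
    (k : EllipticKernel A₀) {x : EuclideanSpace ℝ (Fin n)} {r : ℝ} (hr : 0 < r) (hε : 0 < ε)
    (hU : closedBall x (r * k.D) ⊆ U) {l M C : ℝ} (hl : 0 < l)
    (hcoer : ∀ y ∈ closedBall x (r * k.D), ∀ v, l * ‖v‖ ^ 2 ≤ ⟪A y v, v⟫)
    (hM : ∀ y ∈ closedBall x (r * k.D), ‖A y‖ ≤ M)
    (hC : ∀ y ∈ closedBall x (r * k.D), |c y| ≤ C) (e : EuclideanSpace ℝ (Fin n)) :
    |∫ z, k.η z * ⟪logGradient g ε (x + r • z), e⟫| ≤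
      ‖e‖ * (2 / l * (8 * M ^ 2 * (‖k.B‖ * k.D) ^ 2 / (l * r ^ 2) + C) + 1)
        * volume.real (closedBall (0 : EuclideanSpace ℝ (Fin n)) k.D) := by
  obtain ⟨hTi, hT0⟩ := integral_kernel_identity hA hc hg hgs heq k hr hε hU (fun z => rfl)
  set T : EuclideanSpace ℝ (Fin n) → ℝ := fun z => k.η z ^ 2 *
        ⟪A (x + r • z) (logGradient g ε (x + r • z)), logGradient g ε (x + r • z)⟫
      + 4 / r * (k.η z * ⟪A (x + r • z) (logGradient g ε (x + r • z)), k.B z⟫)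
      + c (x + r • z) * (max (g (x + r • z)) 0 / (max (g (x + r • z)) 0 + ε)) * k.η z ^ 2
    with hTdef
  set N := 8 * M ^ 2 * (‖k.B‖ * k.D) ^ 2 / (l * r ^ 2) + C with hN
  obtain ⟨hbi, hb⟩ := integral_kernel_bound k hTi hT0 (‖e‖ * (2 / l)) (‖e‖ * (2 / l * N + 1))
  rw [← hb, ← Real.norm_eq_abs]
  refine norm_integral_le_of_norm_le hbi (Eventually.of_forall fun z => ?_)
  rw [norm_mul, Real.norm_of_nonneg (k.η_nonneg z)]
  by_cases hz : z ∈ closedBall (0 : EuclideanSpace ℝ (Fin n)) k.D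
  · rw [indicator_of_mem hz]
    have hy : x + r • z ∈ closedBall x (r * k.D) := by
      simp only [mem_closedBall, dist_self_add_left, norm_smul, Real.norm_of_nonneg hr.le]
      gcongr
      simpa using hz
    have h1 := hcoer _ hy (logGradient g ε (x + r • z))
    have h2 := hM _ hy
    have h3 := hC _ hy
    have hη := k.η_nonneg z
    have hη1 := k.η_le_one z
    simp only [hTdef]
    generalize x + r • z = y at *
    generalize logGradient g ε y = V at *
    have h4 : |⟪A y V, k.B z⟫| ≤ M * ‖V‖ * (‖k.B‖ * k.D) := by
      refine (abs_real_inner_le_norm _ _).trans ?_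
      have : 0 ≤ M := (norm_nonneg _).trans h2
      gcongr
      · exact ((A y).le_opNorm V).trans (by gcongr)
      · exact (k.B.le_opNorm z).trans (by gcongr; simpa using hz)
    set β := ‖k.B‖ * k.D
    have h5 : |c y * (max (g y) 0 / (max (g y) 0 + ε)) * k.η z ^ 2| ≤ C := by
      have h0 : 0 ≤ max (g y) 0 := le_max_right _ _
      rw [abs_mul, abs_mul, abs_of_nonneg (show 0 ≤ max (g y) 0 / (max (g y) 0 + ε) by positivity),
        abs_of_nonneg (sq_nonneg (k.η z))]
      have h6 : max (g y) 0 / (max (g y) 0 + ε) ≤ 1 := by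
        rw [div_le_one (by positivity)]; linarith
      have h7 : k.η z ^ 2 ≤ 1 := pow_le_one₀ hη hη1
      calc _ ≤ C * 1 * 1 := by
            have : 0 ≤ C := (abs_nonneg _).trans h3
            gcongr
        _ = C := by ring
    have h6 : ‖⟪V, e⟫‖ ≤ ‖V‖ * ‖e‖ := norm_inner_le_norm _ _
    have h7 : k.η z * ‖V‖ ≤ (k.η z * ‖V‖) ^ 2 + 1 := by nlinarith [sq_nonneg (k.η z * ‖V‖ - 1 / 2)]
    set s := k.η z * ‖V‖ with hs
    have h8 : l * s ^ 2 ≤ k.η z ^ 2 * ⟪A y V, V⟫ := by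
      rw [hs, mul_pow]; nlinarith [sq_nonneg (k.η z)]
    have h9 : |k.η z * ⟪A y V, k.B z⟫| ≤ M * β * s := by
      rw [abs_mul, abs_of_nonneg hη, hs]; nlinarith
    have h10 : 4 / r * (M * β * s) ≤ l / 2 * s ^ 2 + 8 * M ^ 2 * β ^ 2 / (l * r ^ 2) := by
      have : l / 2 * s ^ 2 + 8 * M ^ 2 * β ^ 2 / (l * r ^ 2) - 4 / r * (M * β * s)
          = l / 2 * (s - 4 * M * β / (l * r)) ^ 2 := by field_simp; ring
      have : 0 ≤ l / 2 * (s - 4 * M * β / (l * r)) ^ 2 := by positivity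
      linarith
    have h11 : -(4 / r * (M * β * s)) ≤ 4 / r * (k.η z * ⟪A y V, k.B z⟫) := by
      rw [← mul_neg]; gcongr; exact (abs_le.1 h9).1
    have h12 : l / 2 * s ^ 2 ≤ k.η z ^ 2 * ⟪A y V, V⟫ + 4 / r * (k.η z * ⟪A y V, k.B z⟫)
        + c y * (max (g y) 0 / (max (g y) 0 + ε)) * k.η z ^ 2 + N := by
      linarith [(abs_le.1 h5).1]
    have h13 : s ^ 2 ≤ 2 / l * (k.η z ^ 2 * ⟪A y V, V⟫ + 4 / r * (k.η z * ⟪A y V, k.B z⟫)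
        + c y * (max (g y) 0 / (max (g y) 0 + ε)) * k.η z ^ 2 + N) := by
      have h := mul_le_mul_of_nonneg_left h12 (show 0 ≤ 2 / l by positivity)
      rwa [show 2 / l * (l / 2 * s ^ 2) = s ^ 2 by field_simp] at h
    calc k.η z * ‖⟪V, e⟫‖ ≤ k.η z * (‖V‖ * ‖e‖) := by gcongr
      _ = ‖e‖ * s := by rw [hs]; ring
      _ ≤ ‖e‖ * (s ^ 2 + 1) := by gcongr
      _ ≤ ‖e‖ * (2 / l * (k.η z ^ 2 * ⟪A y V, V⟫ + 4 / r * (k.η z * ⟪A y V, k.B z⟫)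
        + c y * (max (g y) 0 / (max (g y) 0 + ε)) * k.η z ^ 2 + N) + 1) := by gcongr
      _ = _ := by ring
  · rw [indicator_of_notMem hz]
    have : k.η z = 0 := by
      simp only [mem_closedBall, dist_zero_right, not_le] at hz
      exact k.η_eq_zero z hz.le
    simp [hTdef, this]

theorem integral_kernel_radial_le (hA : Continuous A) (hc : Continuous c)
    (hg : ContDiff ℝ 1 g) (hgs : HasCompactSupport g)
    (heq : ∀ ψ, IsTestOn U ψ →
      ∫ y, ⟪A y (posGradient g y), gradient ψ y⟫ = ∫ y, c y * max (g y) 0 * ψ y)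
    (k : EllipticKernel A₀) (hsymm : ∀ v w, ⟪A₀ v, w⟫ = ⟪v, A₀ w⟫)
    {x : EuclideanSpace ℝ (Fin n)} {r : ℝ} (hr : 0 < r) (hε : 0 < ε)
    (hU : closedBall x (r * k.D) ⊆ U) {l ω C : ℝ} (hl : 0 < l)
    (hcoer : ∀ y ∈ closedBall x (r * k.D), ∀ v, l * ‖v‖ ^ 2 ≤ ⟪A y v, v⟫)
    (hω : ∀ y ∈ closedBall x (r * k.D), ‖A y - A₀‖ ≤ ω)
    (hC : ∀ y ∈ closedBall x (r * k.D), |c y| ≤ C) :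
    ∫ z, k.η z * ⟪logGradient g ε (x + r • z), z⟫ ≤
      (ω ^ 2 * (‖k.B‖ * k.D) ^ 2 / (l * r) + C * r / 4)
        * volume.real (closedBall (0 : EuclideanSpace ℝ (Fin n)) k.D) := by
  obtain ⟨K, hK⟩ := hg.lipschitzWith_of_hasCompactSupport hgs one_ne_zero
  obtain ⟨hTi, hT0⟩ := integral_kernel_identity hA hc hg hgs heq k hr hε hU (fun z => rfl)
  set T : EuclideanSpace ℝ (Fin n) → ℝ := fun z => k.η z ^ 2 *
        ⟪A (x + r • z) (logGradient g ε (x + r • z)), logGradient g ε (x + r • z)⟫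
      + 4 / r * (k.η z * ⟪A (x + r • z) (logGradient g ε (x + r • z)), k.B z⟫)
      + c (x + r • z) * (max (g (x + r • z)) 0 / (max (g (x + r • z)) 0 + ε)) * k.η z ^ 2
    with hTdef
  set N := ω ^ 2 * (‖k.B‖ * k.D) ^ 2 / (l * r) + C * r / 4 with hN
  obtain ⟨hbi, hb⟩ := integral_kernel_bound k hTi hT0 (r / 4) N
  rw [← hb]
  have hη0 : ∀ z, z ∉ closedBall (0 : EuclideanSpace ℝ (Fin n)) k.D → k.η z = 0 := fun z hz => by
    simp only [mem_closedBall, dist_zero_right, not_le] at hz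
    exact k.η_eq_zero z hz.le
  have hint : Integrable fun z => k.η z * ⟪logGradient g ε (x + r • z), z⟫ := by
    have hVm : Measurable fun z => logGradient g ε (x + r • z) :=
      (measurable_logGradient hg.continuous.measurable).comp (by fun_prop)
    have := integrable_inner_apply (μ := volume)
      (A := fun _ : EuclideanSpace ℝ (Fin n) => ContinuousLinearMap.id ℝ _)
      continuous_const (Y := fun z => k.η z • z) hVm
      (k.continuous_η.measurable.smul measurable_id) (isCompact_closedBall 0 k.D)
      (a := ε⁻¹ * K) (b := 1 * k.D) (fun z _ => norm_logGradient_le hK hε _)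
      (fun z hz => ?_) fun z hz => Or.inr ?_
    · simpa [inner_smul_right] using this
    · rw [norm_smul, Real.norm_of_nonneg (k.η_nonneg z)]
      gcongr
      · exact k.η_le_one _
      · simpa using hz
    · simp [hη0 z hz]
  refine integral_mono hint hbi fun z => ?_
  by_cases hz : z ∈ closedBall (0 : EuclideanSpace ℝ (Fin n)) k.D
  · simp only [indicator_of_mem hz]
    have hy : x + r • z ∈ closedBall x (r * k.D) := by
      simp only [mem_closedBall, dist_self_add_left, norm_smul, Real.norm_of_nonneg hr.le]
      gcongr
      simpa using hz
    have h1 := hcoer _ hy (logGradient g ε (x + r • z))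
    have h2 := hω _ hy
    have h3 := hC _ hy
    have hη := k.η_nonneg z
    have hη1 := k.η_le_one z
    simp only [hTdef]
    generalize x + r • z = y at *
    generalize logGradient g ε y = V at *
    have h4 : |⟪(A y - A₀) V, k.B z⟫| ≤ ω * ‖V‖ * (‖k.B‖ * k.D) := by
      refine (abs_real_inner_le_norm _ _).trans ?_
      have : 0 ≤ ω := (norm_nonneg _).trans h2
      gcongr
      · exact ((A y - A₀).le_opNorm V).trans (by gcongr)
      · exact (k.B.le_opNorm z).trans (by gcongr; simpa using hz)
    have h4' : ⟪A y V, k.B z⟫ = ⟪V, z⟫ + ⟪(A y - A₀) V, k.B z⟫ := by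
      rw [sub_apply, inner_sub_left, hsymm V, k.apply_B]
      ring
    set β := ‖k.B‖ * k.D
    have h5 : |c y * (max (g y) 0 / (max (g y) 0 + ε)) * k.η z ^ 2| ≤ C := by
      have h0 : 0 ≤ max (g y) 0 := le_max_right _ _
      rw [abs_mul, abs_mul, abs_of_nonneg (show 0 ≤ max (g y) 0 / (max (g y) 0 + ε) by positivity),
        abs_of_nonneg (sq_nonneg (k.η z))]
      have h6 : max (g y) 0 / (max (g y) 0 + ε) ≤ 1 := by
        rw [div_le_one (by positivity)]; linarith
      have h7 : k.η z ^ 2 ≤ 1 := pow_le_one₀ hη hη1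
      calc _ ≤ C * 1 * 1 := by
            have : 0 ≤ C := (abs_nonneg _).trans h3
            gcongr
        _ = C := by ring
    rw [h4']
    set s := k.η z * ‖V‖ with hs
    have h8 : l * s ^ 2 ≤ k.η z ^ 2 * ⟪A y V, V⟫ := by
      rw [hs, mul_pow]; nlinarith [sq_nonneg (k.η z)]
    have h9 : |k.η z * ⟪(A y - A₀) V, k.B z⟫| ≤ ω * β * s := by
      rw [abs_mul, abs_of_nonneg hη, hs]; nlinarith
    have h10 : 4 / r * (ω * β * s) ≤ l * s ^ 2 + 4 * ω ^ 2 * β ^ 2 / (l * r ^ 2) := by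
      have : l * s ^ 2 + 4 * ω ^ 2 * β ^ 2 / (l * r ^ 2) - 4 / r * (ω * β * s)
          = l * (s - 2 * ω * β / (l * r)) ^ 2 := by field_simp; ring
      have : 0 ≤ l * (s - 2 * ω * β / (l * r)) ^ 2 := by positivity
      linarith
    have h11 : -(4 / r * (ω * β * s)) ≤ 4 / r * (k.η z * ⟪(A y - A₀) V, k.B z⟫) := by
      rw [← mul_neg]; gcongr; exact (abs_le.1 h9).1
    have h12 : 4 / r * (k.η z * ⟪V, z⟫) ≤ k.η z ^ 2 * ⟪A y V, V⟫
        + 4 / r * (k.η z * (⟪V, z⟫ + ⟪(A y - A₀) V, k.B z⟫))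
        + c y * (max (g y) 0 / (max (g y) 0 + ε)) * k.η z ^ 2
        + (4 * ω ^ 2 * β ^ 2 / (l * r ^ 2) + C) := by
      rw [mul_add (k.η z), mul_add (4 / r)]
      linarith [(abs_le.1 h5).1]
    have h := mul_le_mul_of_nonneg_left h12 (show 0 ≤ r / 4 by positivity)
    rw [show r / 4 * (4 / r * (k.η z * ⟪V, z⟫)) = k.η z * ⟪V, z⟫ by field_simp,
      mul_add (r / 4)] at h
    have h13 : r / 4 * (4 * ω ^ 2 * β ^ 2 / (l * r ^ 2) + C) = N := by
      rw [hN]; field_simp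
    rw [h13] at h
    exact h
  · simp [indicator_of_notMem hz, hTdef, hη0 z hz]

theorem hasDerivAt_integral_affine {E : Type*} [NormedAddCommGroup E] [InnerProductSpace ℝ E]
    [FiniteDimensional ℝ E] [MeasurableSpace E] [BorelSpace E] {η ℓ : E → ℝ} {V : E → E} {D : ℝ}
    {L : NNReal} (hη : Continuous η) (hη0 : ∀ z, D ≤ ‖z‖ → η z = 0) (hℓ : LipschitzWith L ℓ)
    (hV : Measurable V) (hgrad : ∀ᵐ y, HasGradientAt ℓ (V y) y) (x e : E) (r k t : ℝ)
    (hr : r + t * k ≠ 0) :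
    HasDerivAt (fun s => ∫ z, η z * ℓ (x + s • e + (r + s * k) • z))
      (∫ z, η z * ⟪V (x + t • e + (r + t * k) • z), e + k • z⟫) t := by
  have hcs : HasCompactSupport η := HasCompactSupport.intro (isCompact_closedBall (0 : E) D)
    fun z hz => hη0 z (by simp only [mem_closedBall, dist_zero_right, not_le] at hz; exact hz.le)
  have hcont : ∀ s, Continuous fun z => η z * ℓ (x + s • e + (r + s * k) • z) := fun s =>
    hη.mul (hℓ.continuous.comp (by fun_prop))
  refine (hasDerivAt_integral_of_dominated_loc_of_lip (s := univ) univ_mem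
    (bound := fun z => |η z| * (L * ‖e + k • z‖))
    (Eventually.of_forall fun s => (hcont s).aestronglyMeasurable)
    ((hcont t).integrable_of_hasCompactSupport hcs.mul_right) ?_ ?_ ?_ ?_).2
  · refine Measurable.aestronglyMeasurable (hη.measurable.mul (Measurable.inner ?_ ?_))
    · exact hV.comp (by fun_prop)
    · fun_prop
  · refine Eventually.of_forall fun z => LipschitzOnWith.of_dist_le_mul fun a _ b _ => ?_
    rw [Real.coe_nnabs, abs_of_nonneg (by positivity), Real.dist_eq, ← mul_sub, abs_mul, mul_assoc]
    gcongr
    refine (hℓ.dist_le_mul _ _).trans ?_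
    rw [mul_assoc, dist_eq_norm, Real.dist_eq]
    gcongr
    rw [show x + a • e + (r + a * k) • z - (x + b • e + (r + b * k) • z)
      = (a - b) • (e + k • z) by module, norm_smul, Real.norm_eq_abs, mul_comm]
  · exact (Continuous.mul hη.abs (by fun_prop)).integrable_of_hasCompactSupport
      (hcs.abs.mul_right)
  · have hq : Measure.QuasiMeasurePreserving
        (fun z : E => x + t • e + (r + t * k) • z) volume volume :=
      (measurePreserving_add_left volume (x + t • e)).quasiMeasurePreserving.comp
        (Measure.quasiMeasurePreserving_smul volume hr)
    filter_upwards [hq.ae hgrad] with z hz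
    refine HasDerivAt.const_mul _ (HasGradientAt.hasDerivAt_comp hz ?_)
    have h1 : HasDerivAt (fun s : ℝ => s • e) ((1 : ℝ) • e) t := (hasDerivAt_id t).smul_const e
    have h2 : HasDerivAt (fun s : ℝ => (r + s * k) • z) ((1 * k) • z) t :=
      (((hasDerivAt_id t).mul_const k).const_add r).smul_const z
    refine ((h1.const_add x).add h2).congr_deriv ?_
    simp

end LocalEstimates

section LocalMaximumPrinciple

variable {g c : EuclideanSpace ℝ (Fin n) → ℝ} {ε : ℝ}
  {A : EuclideanSpace ℝ (Fin n) → EuclideanSpace ℝ (Fin n) →L[ℝ] EuclideanSpace ℝ (Fin n)}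
  {A₀ : EuclideanSpace ℝ (Fin n) →L[ℝ] EuclideanSpace ℝ (Fin n)}
  {U : Set (EuclideanSpace ℝ (Fin n))}

theorem integrable_kernel_mul (k : EllipticKernel A₀) {ℓ : EuclideanSpace ℝ (Fin n) → ℝ}
    (hℓ : Continuous ℓ) : Integrable fun z => k.η z * ℓ z :=
  (k.continuous_η.mul hℓ).integrable_of_hasCompactSupport <| HasCompactSupport.mul_right <|
    HasCompactSupport.intro (isCompact_closedBall 0 k.D) fun z hz => k.η_eq_zero z <| by
      simp only [mem_closedBall, dist_zero_right, not_le] at hz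
      exact hz.le

theorem continuous_log_posPart_add (hg : Continuous g) (hε : 0 < ε) :
    Continuous fun y => Real.log (max (g y) 0 + ε) :=
  Continuous.log (by fun_prop) fun y => by
    have := le_max_right (g y) 0
    positivity

theorem integral_kernel_log_le (k : EllipticKernel A₀) (hg : ContDiff ℝ 1 g) {L : NNReal}
    (hL : LipschitzWith L g) {x : EuclideanSpace ℝ (Fin n)} (hx : g x ≤ 0) {r : ℝ} (hr : 0 < r) :
    ∫ z, k.η z * Real.log (max (g (x + r • z)) 0 + r) ≤
      (∫ z, k.η z) * Real.log ((L * k.D + 1) * r) := by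
  have hc : Continuous fun z => Real.log (max (g (x + r • z)) 0 + r) :=
    (continuous_log_posPart_add hg.continuous hr).comp
      (by fun_prop : Continuous fun z : EuclideanSpace ℝ (Fin n) => x + r • z)
  rw [← integral_mul_const]
  refine integral_mono (integrable_kernel_mul k hc) (integrable_kernel_mul k continuous_const)
    fun z => ?_
  by_cases hz : k.D ≤ ‖z‖
  · simp [k.η_eq_zero z hz]
  have h0 : 0 ≤ max (g (x + r • z)) 0 := le_max_right _ _
  have h1 : max (g (x + r • z)) 0 ≤ L * (r * k.D) := by
    have hD := k.D_pos
    refine max_le ?_ (by positivity)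
    have h2 := (abs_le.1 (hL.dist_le_mul (x + r • z) x)).2
    rw [dist_self_add_left, norm_smul, Real.norm_of_nonneg hr.le] at h2
    have : L * (r * ‖z‖) ≤ L * (r * k.D) := by gcongr; exact (not_le.1 hz).le
    linarith
  refine mul_le_mul_of_nonneg_left (Real.log_le_log (by positivity) ?_) (k.η_nonneg z)
  linarith

theorem le_integral_kernel_log (k : EllipticKernel A₀) (hg : ContDiff ℝ 1 g)
    {x : EuclideanSpace ℝ (Fin n)} {r d : ℝ} (hd : 0 < d) (hε : 0 < ε)
    (h : ∀ z, ‖z‖ < k.D → d ≤ g (x + r • z)) :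
    (∫ z, k.η z) * Real.log d ≤ ∫ z, k.η z * Real.log (max (g (x + r • z)) 0 + ε) := by
  have hc : Continuous fun z => Real.log (max (g (x + r • z)) 0 + ε) :=
    (continuous_log_posPart_add hg.continuous hε).comp
      (by fun_prop : Continuous fun z : EuclideanSpace ℝ (Fin n) => x + r • z)
  rw [← integral_mul_const]
  refine integral_mono (integrable_kernel_mul k continuous_const) (integrable_kernel_mul k hc)
    fun z => ?_
  by_cases hz : k.D ≤ ‖z‖
  · simp [k.η_eq_zero z hz]
  refine mul_le_mul_of_nonneg_left (Real.log_le_log hd ?_) (k.η_nonneg z)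
  have := h z (not_le.1 hz)
  have := le_max_left (g (x + r • z)) 0
  linarith

theorem integral_kernel_log_translate (hA : Continuous A) (hc : Continuous c)
    (hg : ContDiff ℝ 1 g) (hgs : HasCompactSupport g)
    (heq : ∀ ψ, IsTestOn U ψ →
      ∫ y, ⟪A y (posGradient g y), gradient ψ y⟫ = ∫ y, c y * max (g y) 0 * ψ y)
    (k : EllipticKernel A₀) {x₀ : EuclideanSpace ℝ (Fin n)} {R : ℝ}
    (hU : closedBall x₀ (2 * R) ⊆ U) {l M C : ℝ} (hl : 0 < l)
    (hcoer : ∀ y ∈ closedBall x₀ (2 * R), ∀ v, l * ‖v‖ ^ 2 ≤ ⟪A y v, v⟫)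
    (hM : ∀ y ∈ closedBall x₀ (2 * R), ‖A y‖ ≤ M)
    (hC : ∀ y ∈ closedBall x₀ (2 * R), |c y| ≤ C) {s : ℝ} (hs : 0 < s) (hsD : s * k.D ≤ R)
    {y : EuclideanSpace ℝ (Fin n)} (hy : y ∈ ball x₀ R) (hε : 0 < ε) :
    ∫ z, k.η z * Real.log (max (g (y + s • z)) 0 + ε) ≤
      (∫ z, k.η z * Real.log (max (g (x₀ + s • z)) 0 + ε)) +
      ‖y - x₀‖ * (2 / l * (8 * M ^ 2 * (‖k.B‖ * k.D) ^ 2 / (l * s ^ 2) + C) + 1)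
        * volume.real (closedBall (0 : EuclideanSpace ℝ (Fin n)) k.D) := by
  obtain ⟨K, hK⟩ := hg.lipschitzWith_of_hasCompactSupport hgs one_ne_zero
  obtain ⟨L, hL⟩ := exists_lipschitzWith_log_add (f := fun y => max (g y) 0)
    ⟨K, hK.max_const 0⟩ (fun _ => le_max_right _ _) hε
  have hder := fun t => hasDerivAt_integral_affine k.continuous_η k.η_eq_zero hL
    (measurable_logGradient hg.continuous.measurable)
    (ae_hasGradientAt_log hK (hg.differentiable one_ne_zero) hε) x₀ (y - x₀) s 0 t
    (by simpa using hs.ne')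
  simp only [mul_zero, add_zero, zero_smul] at hder
  have hbound : ∀ t ∈ Icc (0 : ℝ) 1, closedBall (x₀ + t • (y - x₀)) (s * k.D) ⊆
      closedBall x₀ (2 * R) := fun t ht => by
    refine closedBall_subset_closedBall' ?_
    rw [dist_self_add_left, norm_smul, Real.norm_of_nonneg ht.1, ← dist_eq_norm]
    have := mem_ball.1 hy
    have := mul_le_of_le_one_left (dist_nonneg (x := y) (y := x₀)) ht.2
    linarith
  have := (convex_Icc (0 : ℝ) 1).norm_image_sub_le_of_norm_hasDerivWithin_le
    (fun t _ => (hder t).hasDerivWithinAt) (fun t ht =>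
      abs_integral_kernel_inner_le hA hc hg hgs heq k hs hε ((hbound t ht).trans hU) hl
        (fun z hz => hcoer z (hbound t ht hz)) (fun z hz => hM z (hbound t ht hz))
        (fun z hz => hC z (hbound t ht hz)) (y - x₀))
    (left_mem_Icc.2 zero_le_one) (right_mem_Icc.2 zero_le_one)
  simp only [one_smul, add_sub_cancel, zero_smul, add_zero, sub_zero, norm_one, mul_one] at this
  have h2 := (abs_le.1 this).2
  linarith

theorem integral_kernel_log_dilate (hA : Continuous A) (hc : Continuous c)
    (hg : ContDiff ℝ 1 g) (hgs : HasCompactSupport g)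
    (heq : ∀ ψ, IsTestOn U ψ →
      ∫ y, ⟪A y (posGradient g y), gradient ψ y⟫ = ∫ y, c y * max (g y) 0 * ψ y)
    (k : EllipticKernel A₀) (hsymm : ∀ v w, ⟪A₀ v, w⟫ = ⟪v, A₀ w⟫)
    {x₀ : EuclideanSpace ℝ (Fin n)} {s : ℝ} (hU : closedBall x₀ (s * k.D) ⊆ U) {l ω C : ℝ}
    (hl : 0 < l)
    (hcoer : ∀ y ∈ closedBall x₀ (s * k.D), ∀ v, l * ‖v‖ ^ 2 ≤ ⟪A y v, v⟫)
    (hω : ∀ y ∈ closedBall x₀ (s * k.D), ‖A y - A₀‖ ≤ ω)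
    (hC : ∀ y ∈ closedBall x₀ (s * k.D), |c y| ≤ C) {ρ : ℝ} (hρ : 0 < ρ) (hρs : ρ ≤ s)
    (hε : 0 < ε) :
    ∫ z, k.η z * Real.log (max (g (x₀ + s • z)) 0 + ε) ≤
      (∫ z, k.η z * Real.log (max (g (x₀ + ρ • z)) 0 + ε)) +
      (ω ^ 2 * (‖k.B‖ * k.D) ^ 2 / l * (Real.log s - Real.log ρ) + C * (s ^ 2 - ρ ^ 2) / 8)
        * volume.real (closedBall (0 : EuclideanSpace ℝ (Fin n)) k.D) := by
  obtain ⟨K, hK⟩ := hg.lipschitzWith_of_hasCompactSupport hgs one_ne_zero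
  obtain ⟨L, hL⟩ := exists_lipschitzWith_log_add (f := fun y => max (g y) 0)
    ⟨K, hK.max_const 0⟩ (fun _ => le_max_right _ _) hε
  set q := ω ^ 2 * (‖k.B‖ * k.D) ^ 2 / l with hq
  set m := volume.real (closedBall (0 : EuclideanSpace ℝ (Fin n)) k.D)
  have hder : ∀ t : ℝ, t ≠ 0 → HasDerivAt
      (fun r => ∫ z, k.η z * Real.log (max (g (x₀ + r • z)) 0 + ε))
      (∫ z, k.η z * ⟪logGradient g ε (x₀ + t • z), z⟫) t := fun t ht => by
    have := hasDerivAt_integral_affine k.continuous_η k.η_eq_zero hL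
      (measurable_logGradient hg.continuous.measurable)
      (ae_hasGradientAt_log hK (hg.differentiable one_ne_zero) hε) x₀ 0 0 1 t
      (by simpa using ht)
    simpa using this
  have hder2 : ∀ t : ℝ, t ≠ 0 → HasDerivAt (fun r => (q * Real.log r + C * r ^ 2 / 8) * m)
      ((q * t⁻¹ + C * (2 * t) / 8) * m) t := fun t ht => by
    have h1 := (Real.hasDerivAt_log ht).const_mul q
    have h2 : HasDerivAt (fun r : ℝ => C * r ^ 2 / 8) (C * (2 * t) / 8) t := by
      simpa using ((hasDerivAt_pow 2 t).const_mul C).div_const 8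
    exact (h1.add h2).mul_const m
  have hanti : AntitoneOn (fun r => (∫ z, k.η z * Real.log (max (g (x₀ + r • z)) 0 + ε)) -
      (q * Real.log r + C * r ^ 2 / 8) * m) (Icc ρ s) := by
    refine antitoneOn_of_hasDerivWithinAt_nonpos (convex_Icc ρ s)
      (f' := fun t => (∫ z, k.η z * ⟪logGradient g ε (x₀ + t • z), z⟫) -
        (q * t⁻¹ + C * (2 * t) / 8) * m)
      (fun t ht => ?_) (fun t ht => ?_) fun t ht => ?_
    · have ht0 : t ≠ 0 := (hρ.trans_le ht.1).ne'
      exact ((hder t ht0).sub (hder2 t ht0)).continuousAt.continuousWithinAt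
    · have ht0 : t ≠ 0 := (hρ.trans_le (interior_subset ht).1).ne'
      exact ((hder t ht0).sub (hder2 t ht0)).hasDerivWithinAt
    · have ht' := interior_subset ht
      have ht0 : 0 < t := hρ.trans_le ht'.1
      have hsub : closedBall x₀ (t * k.D) ⊆ closedBall x₀ (s * k.D) :=
        closedBall_subset_closedBall (by have := k.D_pos; gcongr; exact ht'.2)
      have := integral_kernel_radial_le hA hc hg hgs heq k hsymm ht0 hε (hsub.trans hU) hl
        (fun z hz => hcoer z (hsub hz)) (fun z hz => hω z (hsub hz)) (fun z hz => hC z (hsub hz))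
      rw [sub_nonpos]
      refine this.trans (le_of_eq ?_)
      rw [hq]
      field_simp
      ring
  have := hanti (left_mem_Icc.2 hρs) (right_mem_Icc.2 hρs) hρs
  dsimp only at this
  linarith

/-- A local strong maximum principle: the zero set of the positive part of a subsolution
in equality form is open. -/
theorem exists_ball_nonpos (hA : Continuous A) (hc : Continuous c)
    (hg : ContDiff ℝ 1 g) (hgs : HasCompactSupport g)
    (heq : ∀ ψ, IsTestOn U ψ →
      ∫ y, ⟪A y (posGradient g y), gradient ψ y⟫ = ∫ y, c y * max (g y) 0 * ψ y)
    {x₀ : EuclideanSpace ℝ (Fin n)} (hU : U ∈ 𝓝 x₀)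
    (hsymm : ∀ v w, ⟪A x₀ v, w⟫ = ⟪v, A x₀ w⟫) {l : ℝ} (hl : 0 < l)
    (hcoer : ∀ v, l * ‖v‖ ^ 2 ≤ ⟪A x₀ v, v⟫) (hx₀ : g x₀ ≤ 0) :
    ∃ R > 0, ∀ y ∈ ball x₀ R, g y ≤ 0 := by
  obtain ⟨k⟩ := exists_ellipticKernel hsymm hl hcoer
  obtain ⟨L, hL⟩ := hg.lipschitzWith_of_hasCompactSupport hgs one_ne_zero
  have hD := k.D_pos
  set m := ∫ z, k.η z
  have hm : 0 < m := k.integral_pos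
  set V := volume.real (closedBall (0 : EuclideanSpace ℝ (Fin n)) k.D)
  have hV : 0 ≤ V := measureReal_nonneg
  obtain ⟨ω, hω0, hωl, hωm⟩ : ∃ ω > 0, ω ≤ l / 2 ∧
      ω ^ 2 * (‖k.B‖ * k.D) ^ 2 / (l / 2) * V ≤ m / 2 := by
    have h1 : Tendsto (fun ω : ℝ => ω ^ 2 * (‖k.B‖ * k.D) ^ 2 / (l / 2) * V) (𝓝[>] 0) (𝓝 0) := by
      have : Continuous fun ω : ℝ => ω ^ 2 * (‖k.B‖ * k.D) ^ 2 / (l / 2) * V := by fun_prop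
      simpa using (this.tendsto 0).mono_left nhdsWithin_le_nhds
    have h2 : ∀ᶠ ω : ℝ in 𝓝[>] 0, ω ≤ l / 2 :=
      nhdsWithin_le_nhds (Iic_mem_nhds (half_pos hl))
    obtain ⟨ω, h⟩ := ((h1.eventually (Iic_mem_nhds (half_pos hm))).and
      (h2.and self_mem_nhdsWithin)).exists
    exact ⟨ω, h.2.2, h.2.1, h.1⟩
  obtain ⟨R, hR, hRU⟩ : ∃ R > 0, closedBall x₀ (2 * R) ⊆ U ∩ {y | ‖A y - A x₀‖ ≤ ω} := by
    have h1 : {y | ‖A y - A x₀‖ ≤ ω} ∈ 𝓝 x₀ := by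
      have : Continuous fun y => ‖A y - A x₀‖ := by fun_prop
      exact this.continuousAt.preimage_mem_nhds (Iic_mem_nhds (by simpa using hω0))
    obtain ⟨R, hR, h⟩ := nhds_basis_closedBall.mem_iff.1 (inter_mem hU h1)
    exact ⟨R / 2, half_pos hR, by rwa [mul_div_cancel₀ R two_ne_zero]⟩
  have hcoer' : ∀ y ∈ closedBall x₀ (2 * R), ∀ v, l / 2 * ‖v‖ ^ 2 ≤ ⟪A y v, v⟫ := fun y hy v => by
    have h1 : ‖A y - A x₀‖ ≤ ω := (hRU hy).2
    have h2 : |⟪(A y - A x₀) v, v⟫| ≤ l / 2 * ‖v‖ * ‖v‖ :=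
      (abs_real_inner_le_norm _ _).trans (by
        gcongr
        exact ((A y - A x₀).le_opNorm v).trans (by gcongr; exact h1.trans hωl))
    rw [sub_apply, inner_sub_left] at h2
    nlinarith [(abs_le.1 h2).1, hcoer v]
  obtain ⟨M, hM⟩ := (isCompact_closedBall x₀ (2 * R)).exists_bound_of_continuousOn hA.continuousOn
  obtain ⟨C, hC⟩ := (isCompact_closedBall x₀ (2 * R)).exists_bound_of_continuousOn hc.continuousOn
  refine ⟨R, hR, fun y hy => ?_⟩
  by_contra! hgy
  obtain ⟨δ, hδ, hyδ⟩ := Metric.mem_nhds_iff.1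
    (hg.continuous.continuousAt.preimage_mem_nhds (Ici_mem_nhds (half_lt_self hgy)))
  set s := min δ R / k.D with hs
  have hs0 : 0 < s := by positivity
  have hsD : s * k.D = min δ R := div_mul_cancel₀ _ hD.ne'
  have hsub : closedBall x₀ (s * k.D) ⊆ closedBall x₀ (2 * R) :=
    closedBall_subset_closedBall (by rw [hsD]; linarith [min_le_right δ R])
  set N := ‖y - x₀‖ * (2 / (l / 2) * (8 * M ^ 2 * (‖k.B‖ * k.D) ^ 2 / (l / 2 * s ^ 2) + C) + 1) * V
  have key : ∀ ρ, 0 < ρ → ρ ≤ s → m * Real.log (g y / 2) - N - m * Real.log (L * k.D + 1)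
      - m / 2 * Real.log s - C * s ^ 2 / 8 * V ≤ m / 2 * Real.log ρ := fun ρ hρ hρs => by
    have h1 := le_integral_kernel_log k hg (x := y) (r := s) (half_pos hgy) hρ fun z hz => by
      refine hyδ ?_
      rw [mem_ball, dist_self_add_left, norm_smul, Real.norm_of_nonneg hs0.le]
      calc s * ‖z‖ < s * k.D := by gcongr
        _ ≤ δ := hsD.trans_le (min_le_left _ _)
    have h2 := integral_kernel_log_translate hA hc hg hgs heq k
      (fun z hz => (hRU hz).1) (half_pos hl) hcoer' hM hC hs0 (hsD.trans_le (min_le_right _ _))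
      hy hρ
    have h3 := integral_kernel_log_dilate hA hc hg hgs heq k hsymm
      (fun z hz => (hRU (hsub hz)).1) (half_pos hl) (fun z hz => hcoer' z (hsub hz))
      (fun z hz => (hRU (hsub hz)).2) (fun z hz => hC z (hsub hz)) hρ hρs hρ
    have h4 := integral_kernel_log_le k hg hL hx₀ hρ
    rw [Real.log_mul (by positivity) hρ.ne'] at h4
    have hC0 : 0 ≤ C := (norm_nonneg _).trans (hC x₀ (mem_closedBall_self (by positivity)))
    have h5 := mul_le_mul_of_nonneg_right hωm (sub_nonneg.2 (Real.log_le_log hρ hρs))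
    have h6 : C * (s ^ 2 - ρ ^ 2) / 8 * V ≤ C * s ^ 2 / 8 * V := by
      gcongr; linarith [sq_nonneg ρ]
    change m * Real.log (g y / 2) ≤ _ at h1
    change _ ≤ _ + N at h2
    change _ ≤ _ + _ * V at h3
    change _ ≤ m * _ at h4
    rw [add_mul, mul_right_comm] at h3
    linarith
  obtain ⟨ρ, ⟨hρ, hρs⟩, hρ0⟩ := ((((Real.tendsto_log_nhdsGT_zero.const_mul_atBot
    (half_pos hm)).eventually_lt_atBot (m * Real.log (g y / 2) - N - m * Real.log (L * k.D + 1)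
      - m / 2 * Real.log s - C * s ^ 2 / 8 * V)).and
    (nhdsWithin_le_nhds (Iic_mem_nhds hs0))).and self_mem_nhdsWithin).exists
  exact absurd (key ρ hρ0 hρs) (not_le.2 hρ)

end LocalMaximumPrinciple

section GlobalMaximumPrinciple

variable {g c : EuclideanSpace ℝ (Fin n) → ℝ}
  {A : EuclideanSpace ℝ (Fin n) → EuclideanSpace ℝ (Fin n) →L[ℝ] EuclideanSpace ℝ (Fin n)}
  {Ω : Set (EuclideanSpace ℝ (Fin n))}

/-- A function whose positive part solves a linear elliptic equation on a connected open set is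
either nonpositive or everywhere positive there. -/
theorem forall_nonpos_or_forall_pos (hΩ : IsOpen Ω) (hconn : IsPreconnected Ω)
    (hA : Continuous A) (hc : Continuous c) (hsymm : ∀ x v w, ⟪A x v, w⟫ = ⟪v, A x w⟫)
    (hcoer : ∀ x, ∃ l > 0, ∀ v, l * ‖v‖ ^ 2 ≤ ⟪A x v, v⟫) (hg : ContDiffOn ℝ 1 g Ω)
    (heq : ∀ ψ, IsTestOn Ω ψ → ∫ y in Ω, ⟪A y (posGradient g y), gradient ψ y⟫
      = ∫ y in Ω, c y * max (g y) 0 * ψ y) :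
    (∀ x ∈ Ω, g x ≤ 0) ∨ ∀ x ∈ Ω, 0 < g x := by
  have hloc : ∀ x₀ ∈ Ω, g x₀ ≤ 0 → ∀ᶠ y in 𝓝 x₀, g y ≤ 0 := fun x₀ hx₀ hgx₀ => by
    obtain ⟨χ, hχ, hχs, hχΩ, -, U, hUo, hxU, hχ1⟩ := exists_contDiff_cutoff hΩ
      (isCompact_singleton (x := x₀)) (singleton_subset_iff.2 hx₀)
    have hxU : x₀ ∈ U := singleton_subset_iff.1 hxU
    have hGg : ∀ y ∈ U, (fun x => χ x * g x) =ᶠ[𝓝 y] g := fun y hy => by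
      filter_upwards [hUo.mem_nhds hy] with z hz
      rw [hχ1 z hz, one_mul]
    have hGpos : ∀ y ∈ U, posGradient (fun x => χ x * g x) y = posGradient g y := fun y hy => by
      simp only [posGradient, hχ1 y hy, one_mul, (hGg y hy).gradient_eq]
    obtain ⟨l, hl, hcoer'⟩ := hcoer x₀
    have h0 : ∀ ψ, IsTestOn (U ∩ Ω) ψ → ∀ y, y ∉ U ∩ Ω → ψ y = 0 ∧ gradient ψ y = 0 :=
      fun ψ hψ y hy => ⟨image_eq_zero_of_notMem_tsupport fun h => hy (hψ.2.2 h),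
        gradient_eq_zero_of_notMem_tsupport fun h => hy (hψ.2.2 h)⟩
    have heqG : ∀ ψ, IsTestOn (U ∩ Ω) ψ →
        ∫ y, ⟪A y (posGradient (fun x => χ x * g x) y), gradient ψ y⟫
          = ∫ y, c y * max (χ y * g y) 0 * ψ y := fun ψ hψ => by
      have hψΩ := heq ψ ⟨hψ.1, hψ.2.1, hψ.2.2.trans inter_subset_right⟩
      rw [setIntegral_eq_integral_of_forall_compl_eq_zero
        fun y hy => by rw [(h0 ψ hψ y fun h => hy h.2).2, inner_zero_right],
        setIntegral_eq_integral_of_forall_compl_eq_zero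
        fun y hy => by rw [(h0 ψ hψ y fun h => hy h.2).1, mul_zero]] at hψΩ
      refine Eq.trans (integral_congr_ae (Eventually.of_forall fun y => ?_))
        (hψΩ.trans (integral_congr_ae (Eventually.of_forall fun y => ?_)))
      · by_cases hy : y ∈ U
        · simp only [hGpos y hy]
        · simp [(h0 ψ hψ y fun h => hy h.1).2]
      · by_cases hy : y ∈ U
        · simp only [hχ1 y hy, one_mul]
        · simp [(h0 ψ hψ y fun h => hy h.1).1]
    obtain ⟨R, hR, h⟩ := exists_ball_nonpos hA hc
      (contDiff_mul_of_tsupport_subset hΩ hχ hχΩ hg) hχs.mul_right heqG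
      (inter_mem (hUo.mem_nhds hxU) (hΩ.mem_nhds hx₀)) (hsymm x₀) hl hcoer'
      (by rwa [hχ1 x₀ hxU, one_mul])
    filter_upwards [ball_mem_nhds x₀ hR, hUo.mem_nhds hxU] with y hy hyU
    simpa [hχ1 y hyU] using h y hy
  by_contra! hcon
  obtain ⟨⟨x, hx, hgx⟩, y, hy, hgy⟩ := hcon
  obtain ⟨z, -, hz1, hz2⟩ := hconn (interior {x | g x ≤ 0}) (Ω ∩ g ⁻¹' Ioi 0) isOpen_interior
    (hg.continuousOn.isOpen_inter_preimage hΩ isOpen_Ioi)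
    (fun z hz => (le_or_gt (g z) 0).imp (fun h => mem_interior_iff_mem_nhds.2 (hloc z hz h))
      fun h => ⟨hz, h⟩)
    ⟨y, hy, mem_interior_iff_mem_nhds.2 (hloc y hy hgy)⟩ ⟨x, hx, hx, hgx⟩
  have hz3 : z ∈ {x | g x ≤ 0} := interior_subset hz1
  exact (mem_ofPred.1 hz3).not_gt hz2.2

end GlobalMaximumPrinciple

section Truncation

variable {g c φ : EuclideanSpace ℝ (Fin n) → ℝ}
  {A : EuclideanSpace ℝ (Fin n) → EuclideanSpace ℝ (Fin n) →L[ℝ] EuclideanSpace ℝ (Fin n)}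
  {Ω : Set (EuclideanSpace ℝ (Fin n))}

/-- The gradient of `(g - δ)₊`. -/
def truncGradient (g : EuclideanSpace ℝ (Fin n) → ℝ) (δ : ℝ) (x : EuclideanSpace ℝ (Fin n)) :
    EuclideanSpace ℝ (Fin n) :=
  if δ < g x then gradient g x else 0

theorem exists_truncation (hΩ : IsOpen Ω) (hg : Continuous g) (hg1 : ContDiffOn ℝ 1 g Ω)
    (hgb : ∀ x ∈ frontier Ω, g x ≤ 0) (hφ : ∃ K, LipschitzWith K φ) (hφs : HasCompactSupport φ)
    {δ : ℝ} (hδ : 0 < δ) :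
    ∃ ξ, IsTestOn Ω ξ ∧ (∀ x ∈ Ω, ξ x = max (g x - δ) 0 * φ x) ∧
      ∀ᵐ x ∂volume.restrict Ω,
        gradient ξ x = max (g x - δ) 0 • gradient φ x + φ x • truncGradient g δ x := by
  have hK : IsCompact (tsupport φ ∩ (closure Ω ∩ g ⁻¹' Ici δ)) :=
    hφs.inter_right (isClosed_closure.inter (isClosed_Ici.preimage hg))
  have hKΩ : tsupport φ ∩ (closure Ω ∩ g ⁻¹' Ici δ) ⊆ Ω := fun x hx => by
    by_contra h
    have h1 := hgb x (by rw [hΩ.frontier_eq]; exact ⟨hx.2.1, h⟩)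
    have h2 : δ ≤ g x := hx.2.2
    linarith
  obtain ⟨χ, hχ, hχs, hχΩ, hχI, U, hUo, hKU, hχ1⟩ := exists_contDiff_cutoff hΩ hK hKΩ
  set G : EuclideanSpace ℝ (Fin n) → ℝ := fun x => χ x * g x with hG
  have hG1 : ContDiff ℝ 1 G := contDiff_mul_of_tsupport_subset hΩ hχ hχΩ hg1
  have hGs : HasCompactSupport G := hχs.mul_right
  obtain ⟨L, hL⟩ := hG1.lipschitzWith_of_hasCompactSupport hGs one_ne_zero
  obtain ⟨M, hM⟩ := hG1.continuous.bounded_above_of_compact_support hGs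
  obtain ⟨K, hK⟩ := hφ
  obtain ⟨N, hN⟩ := hK.continuous.bounded_above_of_compact_support hφs
  have hsmall : ∀ x, g x < δ → G x < δ := fun x hx => by
    rcases le_or_gt (g x) 0 with h | h
    · exact (mul_nonpos_of_nonneg_of_nonpos (hχI x).1 h).trans_lt hδ
    · exact (mul_le_of_le_one_left h.le (hχI x).2).trans_lt hx
  have hlarge : ∀ x ∈ Ω, x ∈ tsupport φ → δ ≤ g x → G =ᶠ[𝓝 x] g := fun x hx hxφ hxg => by
    filter_upwards [hUo.mem_nhds (hKU ⟨hxφ, subset_closure hx, hxg⟩)] with y hy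
    simp only [hG, hχ1 y hy, one_mul]
  have hval : ∀ x ∈ Ω, x ∈ tsupport φ → max (G x - δ) 0 = max (g x - δ) 0 ∧
      truncGradient G δ x = truncGradient g δ x := fun x hx hxφ => by
    rcases le_or_gt δ (g x) with h | h
    · have := hlarge x hx hxφ h
      simp only [truncGradient, this.eq_of_nhds, this.gradient_eq, and_self]
    · have := hsmall x h
      rw [truncGradient, truncGradient, if_neg this.le.not_gt, if_neg h.le.not_gt,
        max_eq_right (by linarith), max_eq_right (by linarith)]
      exact ⟨rfl, rfl⟩
  have hGL : ∃ K, LipschitzWith K fun x => max (G x - δ) 0 :=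
    ⟨L, (LipschitzWith.of_dist_le_mul fun x y => by
      simpa using hL.dist_le_mul x y : LipschitzWith L fun x => G x - δ).max_const 0⟩
  refine ⟨fun x => max (G x - δ) 0 * φ x, ⟨exists_lipschitzWith_mul hGL ⟨K, hK⟩ (a := M)
    (fun x => ?_) hN, hφs.mul_left, (closure_mono fun x hx => ?_).trans hχΩ⟩, fun x hx => ?_, ?_⟩
  · have h1 := (abs_le.1 (hM x)).2
    have h2 := (norm_nonneg _).trans (hM x)
    rw [abs_of_nonneg (le_max_right _ _)]
    exact max_le (by linarith) h2
  · contrapose! hx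
    rw [Function.notMem_support] at hx ⊢
    simp [hG, hx, hδ.le]
  · by_cases h : x ∈ tsupport φ
    · simp only [(hval x hx h).1]
    · simp [image_eq_zero_of_notMem_tsupport h]
  · have h1 := ae_hasGradientAt_max_zero (μ := volume) hL (hG1.differentiable one_ne_zero) δ
    filter_upwards [ae_restrict_mem hΩ.measurableSet, ae_restrict_of_ae h1,
      ae_restrict_of_ae hK.ae_differentiableAt] with x hx hx1 hx2
    rw [(hx1.mul_real hx2.hasGradientAt).gradient]
    change max (G x - δ) 0 • gradient φ x + φ x • truncGradient G δ x = _
    by_cases h : x ∈ tsupport φ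
    · rw [(hval x hx h).1, (hval x hx h).2]
    · simp [image_eq_zero_of_notMem_tsupport h, gradient_eq_zero_of_notMem_tsupport h]

end Truncation

theorem sq_integral_le_of_forall_nonneg {X : Type*} [MeasurableSpace X] {μ : Measure X}
    {P S R : X → ℝ} (hP : Integrable P μ) (hS : Integrable S μ) (hR : Integrable R μ)
    (h : ∀ t : ℝ, 0 ≤ ∫ x, (P x + 2 * t * S x + t ^ 2 * R x) ∂μ) :
    (∫ x, S x ∂μ) ^ 2 ≤ (∫ x, P x ∂μ) * ∫ x, R x ∂μ := by
  have := discrim_le_zero (a := ∫ x, R x ∂μ) (b := 2 * ∫ x, S x ∂μ) (c := ∫ x, P x ∂μ) fun t => by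
    have h1 := h t
    rw [integral_add (by exact hP.add (hS.const_mul _)) (hR.const_mul _),
      integral_add hP (hS.const_mul _), integral_const_mul, integral_const_mul] at h1
    linarith
  rw [discrim] at this
  linarith

theorem tendsto_zero_of_sq_le {S b : ℕ → ℝ} (h : ∀ j, S j ^ 2 ≤ b j)
    (hb : Tendsto b atTop (𝓝 0)) : Tendsto S atTop (𝓝 0) := by
  refine squeeze_zero_norm (fun j => Real.abs_le_sqrt (h j)) ?_
  simpa using! (Real.continuous_sqrt.tendsto 0).comp hb

theorem ContDiffOn.continuousOn_gradient {E : Type*} [NormedAddCommGroup E]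
    [InnerProductSpace ℝ E] [CompleteSpace E] {g : E → ℝ} {Ω : Set E} (hg : ContDiffOn ℝ 1 g Ω)
    (hΩ : IsOpen Ω) : ContinuousOn (gradient g) Ω :=
  (InnerProductSpace.toDual ℝ E).symm.continuous.comp_continuousOn
    (hg.continuousOn_fderiv_of_isOpen hΩ le_rfl)

section WeakForm

variable {g c φ ξ ψ : EuclideanSpace ℝ (Fin n) → ℝ}
  {A : EuclideanSpace ℝ (Fin n) → EuclideanSpace ℝ (Fin n) →L[ℝ] EuclideanSpace ℝ (Fin n)}
  {Ω : Set (EuclideanSpace ℝ (Fin n))}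

theorem IsTestOn.continuous (hψ : IsTestOn Ω ψ) : Continuous ψ :=
  hψ.1.choose_spec.continuous

theorem IsTestOn.ae_differentiableAt (hψ : IsTestOn Ω ψ) : ∀ᵐ x, DifferentiableAt ℝ ψ x :=
  hψ.1.choose_spec.ae_differentiableAt

theorem IsTestOn.add_mul (hξ : IsTestOn Ω ξ) (hψ : IsTestOn Ω ψ) (t : ℝ) :
    IsTestOn Ω (fun x => ξ x + t * ψ x) := by
  obtain ⟨K, hK⟩ := hξ.1
  obtain ⟨L, hL⟩ := hψ.1
  have hs : tsupport (fun x => t * ψ x) ⊆ tsupport ψ := tsupport_mul_subset_right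
  exact ⟨⟨_, hK.add ((lipschitzWith_smul t).comp hL)⟩, hξ.2.1.add hψ.2.1.mul_left,
    (tsupport_add ξ fun x => t * ψ x).trans (union_subset hξ.2.2 (hs.trans hψ.2.2))⟩

theorem integrable_inner_gradient (hA : Continuous A) (hξ : ∃ K, LipschitzWith K ξ)
    (hψ : ∃ K, LipschitzWith K ψ) (hs : HasCompactSupport ψ)
    (μ : Measure (EuclideanSpace ℝ (Fin n))) [IsFiniteMeasureOnCompacts μ] :
    Integrable (fun x => ⟪A x (gradient ξ x), gradient ψ x⟫) μ := by
  obtain ⟨K, hK⟩ := hξ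
  obtain ⟨L, hL⟩ := hψ
  exact integrable_inner_apply hA (measurable_gradient ξ) (measurable_gradient ψ) hs
    (fun x _ => norm_gradient_le_of_lipschitz hK x) (fun x _ => norm_gradient_le_of_lipschitz hL x)
    fun x hx => Or.inr (gradient_eq_zero_of_notMem_tsupport hx)

theorem sq_weakForm_le (hA : Continuous A) (hc : Continuous c)
    (hsymm : ∀ x v w, ⟪A x v, w⟫ = ⟪v, A x w⟫)
    (hstab : ∀ ψ, IsTestOn Ω ψ →
      0 ≤ ∫ x in Ω, (⟪A x (gradient ψ x), gradient ψ x⟫ - c x * ψ x ^ 2))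
    (hξ : IsTestOn Ω ξ) (hψ : IsTestOn Ω ψ) :
    (∫ x in Ω, (⟪A x (gradient ξ x), gradient ψ x⟫ - c x * ξ x * ψ x)) ^ 2 ≤
      (∫ x in Ω, (⟪A x (gradient ξ x), gradient ξ x⟫ - c x * ξ x ^ 2)) *
        ∫ x in Ω, (⟪A x (gradient ψ x), gradient ψ x⟫ - c x * ψ x ^ 2) := by
  have hξc := hξ.continuous
  have hψc := hψ.continuous
  have hsq : ∀ ζ, IsTestOn Ω ζ →
      Integrable (fun x => ⟪A x (gradient ζ x), gradient ζ x⟫ - c x * ζ x ^ 2)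
        (volume.restrict Ω) := fun ζ hζ => by
    have hζc := hζ.continuous
    refine (integrable_inner_gradient hA hζ.1 hζ.1 hζ.2.1 _).sub
      (Continuous.integrable_of_hasCompactSupport (by fun_prop) ?_)
    refine HasCompactSupport.mul_left (hζ.2.1.comp_left (g := fun t => t ^ 2) (by simp))
  refine sq_integral_le_of_forall_nonneg (hsq ξ hξ)
    ((integrable_inner_gradient hA hξ.1 hψ.1 hψ.2.1 _).sub
      (Continuous.integrable_of_hasCompactSupport (by fun_prop) hψ.2.1.mul_left))
    (hsq ψ hψ) fun t => ?_
  refine (hstab _ (hξ.add_mul hψ t)).trans_eq (integral_congr_ae ?_)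
  filter_upwards [ae_restrict_of_ae hξ.ae_differentiableAt,
    ae_restrict_of_ae hψ.ae_differentiableAt] with x hx1 hx2
  have : gradient (fun x => ξ x + t * ψ x) x = gradient ξ x + t • gradient ψ x := by
    refine HasGradientAt.gradient ?_
    rw [hasGradientAt_iff_hasFDerivAt, map_add, map_smul]
    exact (hx1.hasGradientAt.hasFDerivAt).add (hx2.hasGradientAt.hasFDerivAt.const_mul t)
  rw [this]
  simp only [map_add, map_smul, inner_add_left, inner_add_right, inner_smul_right,
    real_inner_smul_left]
  rw [hsymm x (gradient ψ x) (gradient ξ x), real_inner_comm _ (gradient ψ x)]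
  ring

theorem weakForm_truncation_le (hΩ : IsOpen Ω) (hA : Continuous A) (hc : Continuous c)
    (hsymm : ∀ x v w, ⟪A x v, w⟫ = ⟪v, A x w⟫) (hpos : ∀ x v, 0 ≤ ⟪A x v, v⟫)
    (hg : Continuous g) (hg1 : ContDiffOn ℝ 1 g Ω) (hgb : ∀ x ∈ frontier Ω, g x ≤ 0)
    (hsol : ∀ ψ, IsTestOn Ω ψ →
      ∫ x in Ω, ⟪A x (gradient g x), gradient ψ x⟫ = ∫ x in Ω, c x * g x * ψ x)
    (hφ : ∃ K, LipschitzWith K φ) (hφs : HasCompactSupport φ) {δ : ℝ} (hδ : 0 < δ)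
    (hξ : IsTestOn Ω ξ) (hξv : ∀ x ∈ Ω, ξ x = max (g x - δ) 0 * φ x)
    (hξg : ∀ᵐ x ∂volume.restrict Ω,
        gradient ξ x = max (g x - δ) 0 • gradient φ x + φ x • truncGradient g δ x) :
    ∫ x in Ω, (⟪A x (gradient ξ x), gradient ξ x⟫ - c x * ξ x ^ 2) ≤
      (∫ x in Ω, max (g x) 0 ^ 2 * ⟪A x (gradient φ x), gradient φ x⟫) +
        δ * ∫ x in Ω, |c x| * max (g x) 0 * φ x ^ 2 := by
  obtain ⟨K, hK⟩ := hφ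
  obtain ⟨N, hN⟩ := hK.continuous.bounded_above_of_compact_support hφs
  have hφc := hK.continuous
  have hξc := hξ.continuous
  obtain ⟨ζ, hζ, hζv, hζg⟩ := exists_truncation hΩ hg hg1 hgb (φ := fun x => φ x * φ x)
    (exists_lipschitzWith_mul ⟨K, hK⟩ ⟨K, hK⟩ hN hN) hφs.mul_right hδ
  have hζc := hζ.continuous
  have i1 : Integrable (fun x => max (g x) 0 ^ 2 * ⟪A x (gradient φ x), gradient φ x⟫)
      (volume.restrict Ω) := by
    have hB : Continuous fun x => max (g x) 0 ^ 2 • A x := by fun_prop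
    simpa [inner_smul_left] using integrable_inner_gradient hB ⟨K, hK⟩ ⟨K, hK⟩ hφs _
  have i2 : Integrable (fun x => |c x| * max (g x) 0 * φ x ^ 2) (volume.restrict Ω) :=
    Continuous.integrable_of_hasCompactSupport (by fun_prop)
      (HasCompactSupport.mul_left (hφs.comp_left (g := fun t => t ^ 2) (by simp)))
  have i3 : Integrable (fun x => ⟪A x (gradient g x), gradient ζ x⟫) (volume.restrict Ω) := by
    obtain ⟨L, hL⟩ := hζ.1
    obtain ⟨M, hM⟩ := hζ.2.1.isCompact.exists_bound_of_continuousOn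
      ((hg1.continuousOn_gradient hΩ).mono hζ.2.2)
    exact integrable_inner_apply hA (measurable_gradient g) (measurable_gradient ζ) hζ.2.1
      hM (fun x _ => norm_gradient_le_of_lipschitz hL x)
      fun x hx => Or.inr (gradient_eq_zero_of_notMem_tsupport hx)
  have i4 : Integrable (fun x => c x * g x * ζ x) (volume.restrict Ω) :=
    Continuous.integrable_of_hasCompactSupport (by fun_prop) hζ.2.1.mul_left
  have i5 : Integrable (fun x => ⟪A x (gradient ξ x), gradient ξ x⟫ - c x * ξ x ^ 2)
      (volume.restrict Ω) := by
    refine (integrable_inner_gradient hA hξ.1 hξ.1 hξ.2.1 _).sub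
      (Continuous.integrable_of_hasCompactSupport (by fun_prop) ?_)
    exact HasCompactSupport.mul_left (hξ.2.1.comp_left (g := fun t => t ^ 2) (by simp))
  have hle := integral_mono_ae i5 ((i1.add (i2.const_mul δ)).add (i3.sub i4)) ?_
  · simp only [Pi.add_apply, Pi.sub_apply] at hle
    rwa [integral_add (by exact i1.add (i2.const_mul δ)) (by exact i3.sub i4),
      integral_add i1 (i2.const_mul δ), integral_sub i3 i4, hsol ζ hζ, sub_self, add_zero,
      integral_const_mul] at hle
  · filter_upwards [ae_restrict_mem hΩ.measurableSet, hξg, hζg,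
      ae_restrict_of_ae hK.ae_differentiableAt] with x hx hx1 hx2 hx3
    simp only [Pi.add_apply, Pi.sub_apply]
    rw [(hx3.hasGradientAt.mul_real hx3.hasGradientAt).gradient] at hx2
    rw [hx1, hx2, hξv x hx, hζv x hx]
    have hq := hpos x (gradient φ x)
    rcases lt_or_ge δ (g x) with h | h
    · have hg0 : 0 < g x := hδ.trans h
      rw [truncGradient, if_pos h, max_eq_left (by linarith), max_eq_left hg0.le]
      simp only [map_add, map_smul, inner_add_left, inner_add_right, inner_smul_right,
        real_inner_smul_left]
      rw [hsymm x (gradient φ x) (gradient g x), real_inner_comm _ (gradient φ x)]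
      have h1 : (g x - δ) ^ 2 * ⟪A x (gradient φ x), gradient φ x⟫ ≤
          g x ^ 2 * ⟪A x (gradient φ x), gradient φ x⟫ := by
        gcongr
        linarith
      have h2 : c x * ((g x - δ) * φ x ^ 2) ≤ |c x| * (g x * φ x ^ 2) := by
        have h4 : 0 ≤ (g x - δ) * φ x ^ 2 := mul_nonneg (by linarith) (sq_nonneg _)
        calc c x * ((g x - δ) * φ x ^ 2) ≤ |c x| * ((g x - δ) * φ x ^ 2) := by
              gcongr; exact le_abs_self _
          _ ≤ |c x| * (g x * φ x ^ 2) := by gcongr; linarith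
      have h3 := mul_le_mul_of_nonneg_left h2 hδ.le
      linarith
    · rw [truncGradient, if_neg h.not_gt, max_eq_right (by linarith)]
      simp only [zero_smul, smul_zero, add_zero, map_zero, inner_zero_right,
        zero_mul, mul_zero, sub_zero, ne_eq, OfNat.ofNat_ne_zero, not_false_eq_true, zero_pow]
      positivity

end WeakForm

section PositivePart

variable {g c ψ : EuclideanSpace ℝ (Fin n) → ℝ} {φ : ℕ → EuclideanSpace ℝ (Fin n) → ℝ}
  {A : EuclideanSpace ℝ (Fin n) → EuclideanSpace ℝ (Fin n) →L[ℝ] EuclideanSpace ℝ (Fin n)}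
  {Ω : Set (EuclideanSpace ℝ (Fin n))}

theorem measurable_truncGradient (hg : Measurable g) (δ : ℝ) : Measurable (truncGradient g δ) :=
  Measurable.ite (measurableSet_lt measurable_const hg) (measurable_gradient g) measurable_const

theorem norm_truncGradient_le (g : EuclideanSpace ℝ (Fin n) → ℝ) (δ : ℝ)
    (x : EuclideanSpace ℝ (Fin n)) : ‖truncGradient g δ x‖ ≤ ‖gradient g x‖ := by
  unfold truncGradient
  split_ifs <;> simp

theorem tendsto_truncGradient {δ : ℕ → ℝ} (hδ : ∀ j, 0 < δ j) (hδ0 : Tendsto δ atTop (𝓝 0))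
    (x : EuclideanSpace ℝ (Fin n)) :
    Tendsto (fun j => truncGradient g (δ j) x) atTop (𝓝 (posGradient g x)) := by
  refine tendsto_const_nhds.congr' ?_
  rcases lt_or_ge 0 (g x) with h | h
  · filter_upwards [hδ0.eventually (gt_mem_nhds h)] with j hj
    simp only [posGradient, truncGradient, if_pos h, if_pos hj]
  · refine Eventually.of_forall fun j => ?_
    simp only [posGradient, truncGradient, if_neg h.not_gt, if_neg (h.trans (hδ j).le).not_gt]

theorem abs_max_sub_zero_le {t δ : ℝ} (hδ : 0 < δ) : |max (t - δ) 0| ≤ |t| := by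
  rw [abs_of_nonneg (le_max_right _ _)]
  exact max_le (by linarith [le_abs_self t]) (abs_nonneg t)

theorem tendsto_integral_truncation (hΩ : IsOpen Ω) (hA : Continuous A) (hc : Continuous c)
    (hg : Continuous g) (hg1 : ContDiffOn ℝ 1 g Ω) (hφ : ∀ j, Continuous (φ j))
    (hφ1 : ∀ K, IsCompact K → K ⊆ closure Ω →
      TendstoUniformlyOn (fun j => φ j) (fun _ => (1 : ℝ)) atTop K)
    {δ : ℕ → ℝ} (hδ : ∀ j, 0 < δ j) (hδ0 : Tendsto δ atTop (𝓝 0)) (hψ : IsTestOn Ω ψ) :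
    Tendsto (fun j => ∫ x in Ω, (φ j x * ⟪A x (truncGradient g (δ j) x), gradient ψ x⟫
        - c x * (max (g x - δ j) 0 * φ j x) * ψ x)) atTop
      (𝓝 (∫ x in Ω, (⟪A x (posGradient g x), gradient ψ x⟫ - c x * max (g x) 0 * ψ x))) := by
  have hψc := hψ.continuous
  obtain ⟨L, hL⟩ := hψ.1
  have hK : IsCompact (tsupport ψ) := hψ.2.1
  obtain ⟨B, hB⟩ := hK.exists_bound_of_continuousOn
    (f := fun x => ‖A x‖ * ‖gradient g x‖)
    (hA.norm.continuousOn.mul ((hg1.continuousOn_gradient hΩ).mono hψ.2.2).norm)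
  obtain ⟨M, hM⟩ := hK.exists_bound_of_continuousOn
    (f := fun x => |c x| * |g x| * |ψ x|) (by fun_prop : Continuous _).continuousOn
  have hzero : ∀ x, x ∉ tsupport ψ → ψ x = 0 ∧ gradient ψ x = 0 := fun x hx =>
    ⟨image_eq_zero_of_notMem_tsupport hx, gradient_eq_zero_of_notMem_tsupport hx⟩
  refine tendsto_integral_filter_of_dominated_convergence
    ((tsupport ψ).indicator fun _ => 2 * (B * L) + 2 * M) ?_ ?_ ?_ ?_
  · refine Eventually.of_forall fun j => Measurable.aestronglyMeasurable ?_
    have h1 : Measurable fun x => A x (truncGradient g (δ j) x) :=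
      isBoundedBilinearMap_apply.continuous.measurable.comp
        (hA.measurable.prodMk (measurable_truncGradient hg.measurable _))
    refine ((hφ j).measurable.mul (h1.inner (measurable_gradient ψ))).sub
      (Continuous.measurable ?_)
    have := hφ j
    fun_prop
  · have h2 := Metric.tendstoUniformlyOn_iff.1 (hφ1 _ hK (hψ.2.2.trans subset_closure)) 1 one_pos
    filter_upwards [h2] with j hj
    refine Eventually.of_forall fun x => ?_
    by_cases hx : x ∈ tsupport ψ
    · rw [indicator_of_mem hx]
      have hφ2 : |φ j x| ≤ 2 := by
        have := abs_lt.1 (Real.dist_eq _ _ ▸ hj x hx)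
        rw [abs_le]
        constructor <;> linarith
      have hBx := hB x hx
      have hMx := hM x hx
      rw [Real.norm_of_nonneg (by positivity)] at hBx hMx
      refine (norm_sub_le _ _).trans (add_le_add ?_ ?_)
      · rw [norm_mul]
        refine mul_le_mul hφ2 ?_ (norm_nonneg _) zero_le_two
        refine (norm_inner_le_norm _ _).trans ?_
        refine mul_le_mul ?_ (norm_gradient_le_of_lipschitz hL x) (norm_nonneg _)
          ((by positivity : (0 : ℝ) ≤ _).trans hBx)
        refine ((A x).le_opNorm _).trans (le_trans ?_ hBx)
        gcongr
        exact norm_truncGradient_le g _ x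
      · rw [Real.norm_eq_abs, abs_mul, abs_mul, abs_mul]
        calc |c x| * (|max (g x - δ j) 0| * |φ j x|) * |ψ x|
            ≤ |c x| * (|g x| * 2) * |ψ x| :=
              mul_le_mul_of_nonneg_right (mul_le_mul_of_nonneg_left
                (mul_le_mul (abs_max_sub_zero_le (hδ j)) hφ2 (abs_nonneg _) (abs_nonneg _))
                (abs_nonneg _)) (abs_nonneg _)
          _ = 2 * (|c x| * |g x| * |ψ x|) := by ring
          _ ≤ 2 * M := by gcongr
    · simp [indicator_of_notMem hx, hzero x hx]
  · exact ((integrableOn_const hK.measure_lt_top.ne).integrable_indicator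
      hK.measurableSet).restrict
  · filter_upwards [ae_restrict_mem hΩ.measurableSet] with x hx
    have h1 : Tendsto (fun j => φ j x) atTop (𝓝 1) :=
      (hφ1 {x} isCompact_singleton (singleton_subset_iff.2 (subset_closure hx))).tendsto_at
        (mem_singleton x)
    have h2 : Tendsto (fun j => max (g x - δ j) 0) atTop (𝓝 (max (g x) 0)) := by
      simpa using (hδ0.const_sub (g x)).max (tendsto_const_nhds (x := (0 : ℝ)))
    have h3 : Tendsto (fun j => ⟪A x (truncGradient g (δ j) x), gradient ψ x⟫) atTop
        (𝓝 ⟪A x (posGradient g x), gradient ψ x⟫) :=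
      (((A x).continuous.tendsto _).comp (tendsto_truncGradient hδ hδ0 x)).inner
        tendsto_const_nhds
    simpa using (h1.mul h3).sub (((h2.mul h1).const_mul (c x)).mul_const (ψ x))

/-- Under stability and decay of the cutoff energy, the positive part of a solution which is
nonpositive on the boundary is again a solution. -/
theorem posPart_weakSolution (hΩ : IsOpen Ω) (hA : Continuous A) (hc : Continuous c)
    (hsymm : ∀ x v w, ⟪A x v, w⟫ = ⟪v, A x w⟫) (hpos : ∀ x v, 0 ≤ ⟪A x v, v⟫)
    (hg : Continuous g) (hg1 : ContDiffOn ℝ 1 g Ω) (hgb : ∀ x ∈ frontier Ω, g x ≤ 0)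
    (hsol : ∀ ψ, IsTestOn Ω ψ →
      ∫ x in Ω, ⟪A x (gradient g x), gradient ψ x⟫ = ∫ x in Ω, c x * g x * ψ x)
    (hstab : ∀ ψ, IsTestOn Ω ψ →
      0 ≤ ∫ x in Ω, (⟪A x (gradient ψ x), gradient ψ x⟫ - c x * ψ x ^ 2))
    (hφ : ∀ j, ∃ K, LipschitzWith K (φ j)) (hφs : ∀ j, HasCompactSupport (φ j))
    (hφ1 : ∀ K, IsCompact K → K ⊆ closure Ω →
      TendstoUniformlyOn (fun j => φ j) (fun _ => (1 : ℝ)) atTop K)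
    (hφe : Tendsto (fun j => ∫ x in Ω, max (g x) 0 ^ 2 *
      ⟪A x (gradient (φ j) x), gradient (φ j) x⟫) atTop (𝓝 0)) (hψ : IsTestOn Ω ψ) :
    ∫ x in Ω, ⟪A x (posGradient g x), gradient ψ x⟫ = ∫ x in Ω, c x * max (g x) 0 * ψ x := by
  have hφc : ∀ j, Continuous (φ j) := fun j => (hφ j).choose_spec.continuous
  have hψc := hψ.continuous
  obtain ⟨L, hL⟩ := hψ.1
  set C : ℕ → ℝ := fun j => ∫ x in Ω, |c x| * max (g x) 0 * φ j x ^ 2 with hC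
  have hC0 : ∀ j, 0 ≤ C j := fun j => integral_nonneg fun x => by positivity
  set δ : ℕ → ℝ := fun j => 1 / ((j : ℝ) + 1) / (C j + 1) with hδdef
  have hδ : ∀ j, 0 < δ j := fun j => by have := hC0 j; positivity
  have hδ0 : Tendsto δ atTop (𝓝 0) :=
    squeeze_zero (fun j => (hδ j).le)
      (fun j => div_le_self (by positivity) (by linarith [hC0 j]))
      tendsto_one_div_add_atTop_nhds_zero_nat
  have hδC : ∀ j, δ j * C j ≤ 1 / ((j : ℝ) + 1) := fun j => by
    have := hC0 j
    rw [hδdef, div_mul_eq_mul_div, div_le_iff₀ (by positivity)]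
    gcongr
    linarith
  choose ξ hξ hξv hξg using fun j => exists_truncation hΩ hg hg1 hgb (hφ j) (hφs j) (hδ j)
  have hS : Tendsto (fun j => ∫ x in Ω, (⟪A x (gradient (ξ j) x), gradient ψ x⟫
      - c x * ξ j x * ψ x)) atTop (𝓝 0) := by
    have hb := (hφe.add tendsto_one_div_add_atTop_nhds_zero_nat).mul_const
      (∫ x in Ω, (⟪A x (gradient ψ x), gradient ψ x⟫ - c x * ψ x ^ 2))
    rw [add_zero, zero_mul] at hb
    refine tendsto_zero_of_sq_le (fun j => ?_) hb
    refine (sq_weakForm_le hA hc hsymm hstab (hξ j) hψ).trans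
      (mul_le_mul_of_nonneg_right ?_ (hstab ψ hψ))
    exact (weakForm_truncation_le hΩ hA hc hsymm hpos hg hg1 hgb hsol (hφ j) (hφs j) (hδ j)
      (hξ j) (hξv j) (hξg j)).trans (by gcongr; exact hδC j)
  have iT : ∀ j, Integrable (fun x => max (g x - δ j) 0 *
      ⟪A x (gradient (φ j) x), gradient ψ x⟫) (volume.restrict Ω) := fun j => by
    have hB : Continuous fun x => max (g x - δ j) 0 • A x := by fun_prop
    simpa [inner_smul_left] using integrable_inner_gradient hB (hφ j) hψ.1 hψ.2.1 _
  have hT : Tendsto (fun j => ∫ x in Ω, max (g x - δ j) 0 *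
      ⟪A x (gradient (φ j) x), gradient ψ x⟫) atTop (𝓝 0) := by
    have hb := hφe.mul_const (∫ x in Ω, ⟪A x (gradient ψ x), gradient ψ x⟫)
    rw [zero_mul] at hb
    refine tendsto_zero_of_sq_le (fun j => ?_) hb
    have i1 : Integrable (fun x => max (g x - δ j) 0 ^ 2 *
        ⟪A x (gradient (φ j) x), gradient (φ j) x⟫) (volume.restrict Ω) := by
      have hB : Continuous fun x => max (g x - δ j) 0 ^ 2 • A x := by fun_prop
      simpa [inner_smul_left] using integrable_inner_gradient hB (hφ j) (hφ j) (hφs j) _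
    have i2 : Integrable (fun x => max (g x) 0 ^ 2 *
        ⟪A x (gradient (φ j) x), gradient (φ j) x⟫) (volume.restrict Ω) := by
      have hB : Continuous fun x => max (g x) 0 ^ 2 • A x := by fun_prop
      simpa [inner_smul_left] using integrable_inner_gradient hB (hφ j) (hφ j) (hφs j) _
    refine (sq_integral_le_of_forall_nonneg i1 (iT j)
      (integrable_inner_gradient hA hψ.1 hψ.1 hψ.2.1 _) fun t => ?_).trans
      (mul_le_mul_of_nonneg_right (integral_mono i1 i2 fun x => ?_)
        (integral_nonneg fun x => hpos x _))
    · refine integral_nonneg fun x => ?_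
      refine (hpos x (max (g x - δ j) 0 • gradient (φ j) x + t • gradient ψ x)).trans_eq ?_
      simp only [map_add, map_smul, inner_add_left, inner_add_right, inner_smul_right,
        real_inner_smul_left]
      rw [hsymm x (gradient ψ x) (gradient (φ j) x), real_inner_comm _ (gradient ψ x)]
      ring
    · refine mul_le_mul_of_nonneg_right ?_ (hpos x _)
      have := (hδ j).le
      gcongr
      linarith
  have hF := tendsto_integral_truncation hΩ hA hc hg hg1 hφc hφ1 hδ hδ0 hψ
  have hlim := tendsto_nhds_unique hF (((hS.sub hT).congr fun j => ?_))
  · have h0 : IsCompact (tsupport ψ) := hψ.2.1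
    obtain ⟨B, hB⟩ := h0.exists_bound_of_continuousOn
      ((hg1.continuousOn_gradient hΩ).mono hψ.2.2)
    rw [sub_zero, integral_sub ?_ ?_, sub_eq_zero] at hlim
    · exact hlim
    · refine integrable_inner_apply hA (measurable_posGradient hg.measurable)
        (measurable_gradient ψ) h0 (a := B) (fun x hx => ?_)
        (fun x _ => norm_gradient_le_of_lipschitz hL x)
        fun x hx => Or.inr (gradient_eq_zero_of_notMem_tsupport hx)
      exact (norm_truncGradient_le g 0 x).trans (hB x hx)
    · exact Continuous.integrable_of_hasCompactSupport (by fun_prop) hψ.2.1.mul_left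
  · have hξc := (hξ j).continuous
    rw [← integral_sub _ (iT j)]
    · refine integral_congr_ae ?_
      filter_upwards [ae_restrict_mem hΩ.measurableSet, hξg j] with x hx hx1
      rw [hx1, hξv j x hx]
      simp only [map_add, map_smul, inner_add_left, real_inner_smul_left]
      ring
    · exact (integrable_inner_gradient hA (hξ j).1 hψ.1 hψ.2.1 _).sub
        (Continuous.integrable_of_hasCompactSupport (by fun_prop) hψ.2.1.mul_left)

end PositivePart

section Operator

variable {a : ℝ → ℝ}

/-- `Aop a p` as a continuous linear map. -/
def aopCLM (a : ℝ → ℝ) (p : EuclideanSpace ℝ (Fin n)) :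
    EuclideanSpace ℝ (Fin n) →L[ℝ] EuclideanSpace ℝ (Fin n) :=
  a ‖p‖ • ContinuousLinearMap.id ℝ _ + (deriv a ‖p‖ / ‖p‖) • (innerSL ℝ p).smulRight p

theorem aopCLM_apply (a : ℝ → ℝ) (p v : EuclideanSpace ℝ (Fin n)) :
    aopCLM a p v = Aop a p v := by
  simp [aopCLM, Aop, smul_smul]

theorem inner_aopCLM_comm (a : ℝ → ℝ) (p v w : EuclideanSpace ℝ (Fin n)) :
    ⟪aopCLM a p v, w⟫ = ⟪v, aopCLM a p w⟫ := by
  simp only [aopCLM_apply, Aop, inner_add_left, inner_add_right, real_inner_smul_left,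
    real_inner_smul_right, real_inner_comm p v]
  ring

theorem mul_norm_sq_le_inner_aopCLM (a : ℝ → ℝ) (p v : EuclideanSpace ℝ (Fin n)) :
    min (a ‖p‖) (lam1 a ‖p‖) * ‖v‖ ^ 2 ≤ ⟪aopCLM a p v, v⟫ := by
  have hform : ⟪aopCLM a p v, v⟫ = a ‖p‖ * ‖v‖ ^ 2 + deriv a ‖p‖ / ‖p‖ * ⟪p, v⟫ ^ 2 := by
    simp only [aopCLM_apply, Aop, inner_add_left, real_inner_smul_left,
      real_inner_self_eq_norm_sq]
    ring
  rw [hform]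
  rcases le_or_gt 0 (deriv a ‖p‖ / ‖p‖) with h | h
  · have h1 : min (a ‖p‖) (lam1 a ‖p‖) * ‖v‖ ^ 2 ≤ a ‖p‖ * ‖v‖ ^ 2 := by
      gcongr
      exact min_le_left _ _
    nlinarith [mul_nonneg h (sq_nonneg ⟪p, v⟫)]
  · have hp : ‖p‖ ≠ 0 := fun h0 => by simp [h0] at h
    have h1 : min (a ‖p‖) (lam1 a ‖p‖) * ‖v‖ ^ 2 ≤ lam1 a ‖p‖ * ‖v‖ ^ 2 := by
      gcongr
      exact min_le_right _ _
    have h2 : ⟪p, v⟫ ^ 2 ≤ ‖p‖ ^ 2 * ‖v‖ ^ 2 := by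
      rw [← mul_pow, ← sq_abs]
      exact pow_le_pow_left₀ (abs_nonneg _) (abs_real_inner_le_norm p v) 2
    have h3 : deriv a ‖p‖ / ‖p‖ * (‖p‖ ^ 2 * ‖v‖ ^ 2) = ‖p‖ * deriv a ‖p‖ * ‖v‖ ^ 2 := by
      field_simp
    have h4 := mul_le_mul_of_nonpos_left h2 h.le
    have h5 : lam1 a ‖p‖ * ‖v‖ ^ 2 = a ‖p‖ * ‖v‖ ^ 2 + ‖p‖ * deriv a ‖p‖ * ‖v‖ ^ 2 := by
      rw [lam1, add_mul]
    linarith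

theorem continuous_aopCLM (ha : ContDiffOn ℝ 1 a (Ici 0)) :
    Continuous (aopCLM a : EuclideanSpace ℝ (Fin n) → _) := by
  have ha0 : Continuous fun p : EuclideanSpace ℝ (Fin n) => a ‖p‖ :=
    ha.continuousOn.comp_continuous continuous_norm fun p => norm_nonneg p
  have hb : Continuous fun p : EuclideanSpace ℝ (Fin n) => derivWithin a (Ici 0) ‖p‖ :=
    (ha.continuousOn_derivWithin (uniqueDiffOn_Ici 0) le_rfl).comp_continuous continuous_norm
      fun p => norm_nonneg p
  have heq : ∀ p : EuclideanSpace ℝ (Fin n),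
      deriv a ‖p‖ / ‖p‖ = derivWithin a (Ici 0) ‖p‖ / ‖p‖ := fun p => by
    rcases (norm_nonneg p).eq_or_lt with h | h
    · simp [← h]
    · rw [derivWithin_of_mem_nhds (Ici_mem_nhds h)]
  have hS : Continuous fun p : EuclideanSpace ℝ (Fin n) => (innerSL ℝ p).smulRight p := by
    fun_prop
  refine (ha0.smul continuous_const).add ?_
  simp only [heq]
  rw [continuous_iff_continuousAt]
  intro p
  rcases eq_or_ne p 0 with rfl | hp
  · have h0 : Tendsto (fun q : EuclideanSpace ℝ (Fin n) =>
        |derivWithin a (Ici 0) ‖q‖| * ‖q‖) (𝓝 0) (𝓝 0) := by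
      have := (hb.abs.mul continuous_norm).tendsto (0 : EuclideanSpace ℝ (Fin n))
      simpa using! this
    rw [ContinuousAt, norm_zero, div_zero, zero_smul]
    refine squeeze_zero_norm (fun q => ?_) h0
    rw [norm_smul, ContinuousLinearMap.norm_smulRight_apply, innerSL_apply_norm, norm_div,
      norm_norm, Real.norm_eq_abs]
    rcases eq_or_ne ‖q‖ 0 with hq | hq
    · simp [hq]
    · exact (by field_simp : _ = _).le
  · exact (hb.continuousAt.div continuous_norm.continuousAt (norm_ne_zero_iff.2 hp)).smul
      hS.continuousAt

end Operator

theorem ContinuousOn.exists_continuous_eqOn.{v, w} {X : Type v} {Y : Type w} [TopologicalSpace X]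
    [NormalSpace X] [TopologicalSpace Y] [TietzeExtension.{v} Y] {s : Set X} {f : X → Y}
    (hf : ContinuousOn f s) (hs : IsClosed s) : ∃ g : X → Y, Continuous g ∧ EqOn g f s := by
  obtain ⟨g, hg⟩ := ContinuousMap.exists_restrict_eq hs ⟨_, hf.domRestrict⟩
  exact ⟨g, g.continuous, fun x hx => DFunLike.congr_fun hg ⟨x, hx⟩⟩

theorem posGradient_eq_gradient {g : EuclideanSpace ℝ (Fin n) → ℝ}
    {Ω : Set (EuclideanSpace ℝ (Fin n))} (hΩ : IsOpen Ω) (hg : ∀ x ∈ Ω, 0 ≤ g x)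
    {x : EuclideanSpace ℝ (Fin n)} (hx : x ∈ Ω) : posGradient g x = gradient g x := by
  rcases (hg x hx).eq_or_lt with h | h
  · have hmin : IsLocalMin g x := by
      filter_upwards [hΩ.mem_nhds hx] with y hy
      exact h ▸ hg y hy
    simp [posGradient, ← h, gradient, hmin.fderiv_eq_zero]
  · exact if_pos h

/-- The sign trichotomy for continuous coefficients. -/
theorem sign_trichotomy {w c : EuclideanSpace ℝ (Fin n) → ℝ}
    {A : EuclideanSpace ℝ (Fin n) → EuclideanSpace ℝ (Fin n) →L[ℝ] EuclideanSpace ℝ (Fin n)}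
    {Ω : Set (EuclideanSpace ℝ (Fin n))} {φ : ℕ → EuclideanSpace ℝ (Fin n) → ℝ}
    (hΩ : IsOpen Ω) (hconn : IsPreconnected Ω) (hA : Continuous A) (hc : Continuous c)
    (hsymm : ∀ x v w, ⟪A x v, w⟫ = ⟪v, A x w⟫)
    (hcoer : ∀ x, ∃ l > 0, ∀ v, l * ‖v‖ ^ 2 ≤ ⟪A x v, v⟫)
    (hw : Continuous w) (hw1 : ContDiffOn ℝ 1 w Ω) (hwb : ∀ x ∈ frontier Ω, 0 ≤ w x)
    (hsol : ∀ ψ, IsTestOn Ω ψ →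
      ∫ x in Ω, ⟪A x (gradient w x), gradient ψ x⟫ = ∫ x in Ω, c x * w x * ψ x)
    (hstab : ∀ ψ, IsTestOn Ω ψ →
      ∫ x in Ω, c x * ψ x ^ 2 ≤ ∫ x in Ω, ⟪A x (gradient ψ x), gradient ψ x⟫)
    (hφ : ∀ j, ∃ K, LipschitzWith K (φ j)) (hφs : ∀ j, HasCompactSupport (φ j))
    (hφ1 : ∀ K, IsCompact K → K ⊆ closure Ω →
      TendstoUniformlyOn (fun j => φ j) (fun _ => (1 : ℝ)) atTop K)
    (hφe : Tendsto (fun j => ∫ x in Ω, max (-w x) 0 ^ 2 *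
      ⟪A x (gradient (φ j) x), gradient (φ j) x⟫) atTop (𝓝 0)) :
    (∀ x ∈ Ω, w x = 0) ∨ (∀ x ∈ Ω, w x < 0) ∨ ∀ x ∈ Ω, 0 < w x := by
  have hpos : ∀ x v, 0 ≤ ⟪A x v, v⟫ := fun x v => by
    obtain ⟨l, hl, h⟩ := hcoer x
    exact (by positivity : 0 ≤ l * ‖v‖ ^ 2).trans (h v)
  have hstab' : ∀ ψ, IsTestOn Ω ψ →
      0 ≤ ∫ x in Ω, (⟪A x (gradient ψ x), gradient ψ x⟫ - c x * ψ x ^ 2) := fun ψ hψ => by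
    have hψc := hψ.continuous
    rw [integral_sub (integrable_inner_gradient hA hψ.1 hψ.1 hψ.2.1 _)]
    · exact sub_nonneg.2 (hstab ψ hψ)
    · have hs : HasCompactSupport fun x => c x * ψ x ^ 2 :=
        hψ.2.1.mono fun x hx h => hx (by simp [h])
      exact Continuous.integrable_of_hasCompactSupport (by fun_prop) hs
  have hneg : ∀ x, gradient (fun y => -w y) x = -gradient w x := fun x => by
    simp [gradient]
  have hminus := forall_nonpos_or_forall_pos hΩ hconn hA hc hsymm hcoer hw1.neg fun ψ hψ =>
    posPart_weakSolution (g := fun x => -w x) hΩ hA hc hsymm hpos hw.neg hw1.neg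
      (fun x hx => neg_nonpos.2 (hwb x hx))
      (fun ψ hψ => by
        simp only [hneg, map_neg, inner_neg_left, mul_neg, neg_mul, integral_neg, hsol ψ hψ])
      hstab' hφ hφs hφ1 hφe hψ
  rcases hminus with h | h
  · have hw0 : ∀ x ∈ Ω, 0 ≤ w x := fun x hx => neg_nonpos.1 (h x hx)
    have heq : ∀ ψ, IsTestOn Ω ψ → ∫ x in Ω, ⟪A x (posGradient w x), gradient ψ x⟫ =
        ∫ x in Ω, c x * max (w x) 0 * ψ x := fun ψ hψ => by
      convert hsol ψ hψ using 1
      · exact setIntegral_congr_fun hΩ.measurableSet fun x hx => by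
          simp only [posGradient_eq_gradient hΩ hw0 hx]
      · exact setIntegral_congr_fun hΩ.measurableSet fun x hx => by
          simp only [max_eq_left (hw0 x hx)]
    rcases forall_nonpos_or_forall_pos hΩ hconn hA hc hsymm hcoer hw1 heq with h1 | h1
    · exact Or.inl fun x hx => (h1 x hx).antisymm (hw0 x hx)
    · exact Or.inr (Or.inr h1)
  · exact Or.inr (Or.inl fun x hx => neg_pos.1 (h x hx))

/-- Lemma 3.4 of the paper, in `ℝⁿ`: the sign trichotomy for supersolution-type solutions of
the linearized equation under stability and an energy decay condition on `w₋`. -/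
theorem linearized_sign_trichotomy
    (n : ℕ) (Ω : Set (EuclideanSpace ℝ (Fin n)))
    (hne : Ω.Nonempty) (hΩ : IsOpen Ω) (hconn : IsConnected Ω)
    (a : ℝ → ℝ) (ha : ContDiffOn ℝ 1 a (Ici 0))
    (hapos : ∀ t ≥ (0 : ℝ), 0 < a t) (hlam : ∀ t ≥ (0 : ℝ), 0 < lam1 a t)
    (f : ℝ → ℝ) (hf : ContDiff ℝ 1 f)
    (u : EuclideanSpace ℝ (Fin n) → ℝ)
    (hu : ContDiffOn ℝ 1 u Ω) (hucl : ContinuousOn u (closure Ω))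
    (hDuext : ∃ Du : EuclideanSpace ℝ (Fin n) → EuclideanSpace ℝ (Fin n),
      ContinuousOn Du (closure Ω) ∧ ∀ x ∈ Ω, Du x = gradient u x)
    (hstab : IsStable a f Ω u)
    (w : EuclideanSpace ℝ (Fin n) → ℝ)
    (hw1 : ContDiffOn ℝ 1 w Ω) (hwcl : ContinuousOn w (closure Ω))
    (hwsol : ∀ φ : EuclideanSpace ℝ (Fin n) → ℝ, IsTestOn Ω φ →
      ∫ x in Ω, ⟪Aop a (gradient u x) (gradient w x), gradient φ x⟫
        = ∫ x in Ω, deriv f (u x) * w x * φ x)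
    (hwb : ∀ p ∈ frontier Ω, 0 ≤ w p)
    (hφ : ∃ φ : ℕ → EuclideanSpace ℝ (Fin n) → ℝ,
      (∀ j, ∃ K, LipschitzWith K (φ j)) ∧ (∀ j, HasCompactSupport (φ j)) ∧
      (∀ K : Set (EuclideanSpace ℝ (Fin n)), IsCompact K → K ⊆ closure Ω →
        TendstoUniformlyOn (fun j => φ j) (fun _ => (1 : ℝ)) atTop K) ∧
      Tendsto (fun j => ∫ x in Ω, (max (-(w x)) 0) ^ 2 *
          ⟪Aop a (gradient u x) (gradient (φ j) x), gradient (φ j) x⟫)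
        atTop (nhds 0)) :
    (∀ x ∈ Ω, w x = 0) ∨ (∀ x ∈ Ω, w x < 0) ∨ (∀ x ∈ Ω, 0 < w x) := by
  obtain ⟨Du, hDu, hDueq⟩ := hDuext
  obtain ⟨φ, hφL, hφs, hφ1, hφe⟩ := hφ
  have : TietzeExtension.{0} (EuclideanSpace ℝ (Fin n)) := TietzeExtension.of_tvs ℝ
  obtain ⟨P, hP, hPeq⟩ := hDu.exists_continuous_eqOn isClosed_closure
  obtain ⟨U, hU, hUeq⟩ := hucl.exists_continuous_eqOn isClosed_closure
  obtain ⟨W, hW, hWeq⟩ := hwcl.exists_continuous_eqOn isClosed_closure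
  have hP' : ∀ x ∈ Ω, P x = gradient u x := fun x hx =>
    (hPeq (subset_closure hx)).trans (hDueq x hx)
  have hU' : ∀ x ∈ Ω, U x = u x := fun x hx => hUeq (subset_closure hx)
  have hW' : ∀ x ∈ Ω, W x = w x := fun x hx => hWeq (subset_closure hx)
  have hWg : ∀ x ∈ Ω, gradient W x = gradient w x := fun x hx =>
    (show W =ᶠ[𝓝 x] w from eventually_of_mem (hΩ.mem_nhds hx) hW').gradient_eq
  have hop : ∀ x ∈ Ω, ∀ v, aopCLM a (P x) v = Aop a (gradient u x) v := fun x hx v => by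
    rw [aopCLM_apply, hP' x hx]
  have hm := hΩ.measurableSet
  have key := sign_trichotomy (A := fun x => aopCLM a (P x)) (c := fun x => deriv f (U x))
    (φ := φ) hΩ hconn.isPreconnected ((continuous_aopCLM ha).comp hP)
    ((hf.continuous_deriv le_rfl).comp hU) (fun x => inner_aopCLM_comm a (P x))
    (fun x => ⟨_, lt_min (hapos _ (norm_nonneg (P x))) (hlam _ (norm_nonneg (P x))),
      mul_norm_sq_le_inner_aopCLM a (P x)⟩) hW (hw1.congr hW')
    (fun x hx => (hwb x hx).trans_eq (hWeq (frontier_subset_closure hx)).symm)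
    (fun ψ hψ => ?_) (fun ψ hψ => ?_) hφL hφs hφ1 ?_
  · refine key.imp (fun h x hx => ?_) (Or.imp (fun h x hx => ?_) fun h x hx => ?_) <;>
      simpa only [hW' x hx] using h x hx
  · convert hwsol ψ hψ using 1
    · exact setIntegral_congr_fun hm fun x hx => by simp only [hop x hx, hWg x hx]
    · exact setIntegral_congr_fun hm fun x hx => by simp only [hU' x hx, hW' x hx]
  · convert hstab ψ hψ using 1
    · exact setIntegral_congr_fun hm fun x hx => by simp only [hU' x hx]
    · exact setIntegral_congr_fun hm fun x hx => by simp only [hop x hx]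
  · refine hφe.congr fun j => setIntegral_congr_fun hm fun x hx => ?_
    simp only [hop x hx, hW' x hx]
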